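/- arXiv:2403.17274 — 2 statements merged into one kernel-verified Lean document; each statement's English description precedes it below -/
import Mathlib

section
/- Let Φ be an irreducible crystallographic root system. A subset Σ ⊆ Φ⁺ is Worpitzky-compatible if and only if Σ is 2-locally compatible, i.e., for every codimension-2 intersection X of reflecting hyperplanes such that the localization Φ_X is irreducible, the localization Σ_X = Σ ∩ Φ⁺_X is Worpitzky-compatible in Φ_X. -/
open scoped InnerProductSpace

noncomputable section

/-- Ambient Euclidean space `ℝ^ℓ` with the standard inner product. -/
abbrev EucV (ℓ : ℕ) : Type := EuclideanSpace ℝ (Fin ℓ)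

variable {ℓ : ℕ}

/-- `α` is a nonnegative integer combination of elements of `D`. -/
def IsNNIntComb (D : Set (EucV ℓ)) (α : EucV ℓ) : Prop :=
  ∃ (s : Finset (EucV ℓ)) (c : EucV ℓ → ℕ), (↑s : Set (EucV ℓ)) ⊆ D ∧
    α = ∑ b ∈ s, (c b : ℝ) • b

/-- Data of a reduced crystallographic root system `Φ` spanning `ℝ^ℓ`, together with a
fixed simple system `Δ` (every root is a nonnegative or nonpositive integer
combination of `Δ`). -/
structure RootSystemData (ℓ : ℕ) where
  Φ : Set (EucV ℓ)
  Δ : Set (EucV ℓ)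
  finite : Φ.Finite
  nonzero : (0 : EucV ℓ) ∉ Φ
  spanning : Submodule.span ℝ Φ = ⊤
  neg_mem : ∀ α ∈ Φ, -α ∈ Φ
  reduced : ∀ α ∈ Φ, ∀ t : ℝ, t • α ∈ Φ → t = 1 ∨ t = -1
  cryst : ∀ α ∈ Φ, ∀ β ∈ Φ, ∃ n : ℤ, 2 * ⟪β, α⟫_ℝ = (n : ℝ) * ⟪α, α⟫_ℝ
  refl_mem : ∀ α ∈ Φ, ∀ β ∈ Φ, β - (2 * ⟪β, α⟫_ℝ / ⟪α, α⟫_ℝ) • α ∈ Φ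
  simple_sub : Δ ⊆ Φ
  simple_indep : LinearIndependent ℝ (fun a : Δ => (a : EucV ℓ))
  pos_or_neg : ∀ α ∈ Φ, IsNNIntComb Δ α ∨ IsNNIntComb Δ (-α)

/-- A set of vectors is irreducible if it admits no decomposition into two nonempty
mutually orthogonal parts. -/
def IrredSet (S : Set (EucV ℓ)) : Prop :=
  ¬ ∃ S₁ S₂ : Set (EucV ℓ), S₁.Nonempty ∧ S₂.Nonempty ∧ S = S₁ ∪ S₂ ∧
      ∀ a ∈ S₁, ∀ b ∈ S₂, ⟪a, b⟫_ℝ = 0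

namespace RootSystemData

variable (rs : RootSystemData ℓ)

/-- The positive system `Φ⁺` determined by the simple system `Δ`. -/
def Pos : Set (EucV ℓ) := {α ∈ rs.Φ | IsNNIntComb rs.Δ α}

/-- `X` is a codimension-two intersection of reflecting hyperplanes of `Φ`. -/
def IsCodim2Flat (X : Set (EucV ℓ)) : Prop :=
  ∃ α ∈ rs.Pos, ∃ β ∈ rs.Pos, (¬ ∃ t : ℝ, β = t • α) ∧
    X = {x : EucV ℓ | ⟪α, x⟫_ℝ = 0 ∧ ⟪β, x⟫_ℝ = 0}

/-- The localization `Φ_X = Φ ∩ X^⊥`. -/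
def locΦ (X : Set (EucV ℓ)) : Set (EucV ℓ) := {γ ∈ rs.Φ | ∀ x ∈ X, ⟪γ, x⟫_ℝ = 0}

/-- The positive system `Φ⁺_X = Φ⁺ ∩ Φ_X` of the localization. -/
def locPos (X : Set (EucV ℓ)) : Set (EucV ℓ) := rs.Pos ∩ rs.locΦ X

/-- The (two-dimensional) linear span of the localization `Φ_X`, as a set. -/
def locSpan (X : Set (EucV ℓ)) : Set (EucV ℓ) :=
  (Submodule.span ℝ (rs.locΦ X) : Set (EucV ℓ))

end RootSystemData

/-- The indecomposable elements of a positive system `P`; for a positive system of a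
root (sub)system this is the associated simple system. -/
def simplesOf (P : Set (EucV ℓ)) : Set (EucV ℓ) :=
  {α ∈ P | ¬ ∃ β ∈ P, ∃ γ ∈ P, α = β + γ}

/-- The simple system `Δ_X` of the localization `Φ_X` associated to `Φ⁺_X`. -/
def RootSystemData.locΔ (rs : RootSystemData ℓ) (X : Set (EucV ℓ)) : Set (EucV ℓ) :=
  simplesOf (rs.locPos X)

/-- The union of the affine hyperplanes `H_α^n` (`α ∈ P`, `n ∈ ℤ`), traced on the
carrier set `U`. -/
def hypUnion (U P : Set (EucV ℓ)) : Set (EucV ℓ) :=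
  {x ∈ U | ∃ α ∈ P, ∃ n : ℤ, ⟪α, x⟫_ℝ = (n : ℝ)}

/-- `A` is an alcove: a connected component of the complement (in the carrier `U`)
of all the affine hyperplanes `H_α^n`, `α ∈ P`, `n ∈ ℤ`. -/
def IsAlcove (U P A : Set (EucV ℓ)) : Prop :=
  ∃ x ∈ U \ hypUnion U P, A = connectedComponentIn (U \ hypUnion U P) x

/-- `r` is the address of the alcove `A`: for each `γ ∈ P` and `x ∈ A` one has
`r γ - 1 < ⟪γ, x⟫ < r γ`. -/
def IsAddress (P A : Set (EucV ℓ)) (r : EucV ℓ → ℤ) : Prop :=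
  ∀ γ ∈ P, ∀ x ∈ A, ((r γ : ℝ) - 1 < ⟪γ, x⟫_ℝ ∧ ⟪γ, x⟫_ℝ < (r γ : ℝ))

/-- The upper closure `A^◊` of an alcove `A` with address `r`. -/
def upperClos (P A : Set (EucV ℓ)) (r : EucV ℓ → ℤ) : Set (EucV ℓ) :=
  {x ∈ closure A | ∀ γ ∈ P, (r γ : ℝ) - 1 < ⟪γ, x⟫_ℝ}

/-- The hyperplane `H_β^m` (traced on the carrier `U`) is a wall of the alcove `A`,
i.e. it supports a facet of `closure A`: its intersection with `closure A` affinely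
spans the whole trace of the hyperplane on `U`. -/
def IsWall (U : Set (EucV ℓ)) (β : EucV ℓ) (m : ℤ) (A : Set (EucV ℓ)) : Prop :=
  ∀ y ∈ U, ⟪β, y⟫_ℝ = (m : ℝ) →
    y ∈ affineSpan ℝ ({x ∈ U | ⟪β, x⟫_ℝ = (m : ℝ)} ∩ closure A)

/-- The fundamental parallelepiped `P^◊` determined by the simple system `D`,
traced on the carrier `U`. -/
def fundPar (U D : Set (EucV ℓ)) : Set (EucV ℓ) :=
  {x ∈ U | ∀ a ∈ D, 0 < ⟪a, x⟫_ℝ ∧ ⟪a, x⟫_ℝ ≤ 1}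

/-- Worpitzky-compatibility of `S` (inside carrier `U`, with positive system `P` and
simple system `D`): for every alcove `A ⊆ P^◊`, every `α ∈ S` and every `n ∈ ℤ`, the
intersection `A^◊ ∩ H_α^n` is empty or contained in a ceiling `H_β^m` of `A`
(a wall with `m = r(A,β) ≥ 1`) with `β ∈ S`. -/
def WCompat (U P D S : Set (EucV ℓ)) : Prop :=
  ∀ A : Set (EucV ℓ), IsAlcove U P A → A ⊆ fundPar U D →
    ∀ r : EucV ℓ → ℤ, IsAddress P A r →
      ∀ α ∈ S, ∀ n : ℤ,
        upperClos P A r ∩ {x : EucV ℓ | ⟪α, x⟫_ℝ = (n : ℝ)} = ∅ ∨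
        ∃ β ∈ S, ∃ m : ℤ, m = r β ∧ 1 ≤ m ∧ IsWall U β m A ∧
          upperClos P A r ∩ {x : EucV ℓ | ⟪α, x⟫_ℝ = (n : ℝ)} ⊆
            {x : EucV ℓ | ⟪β, x⟫_ℝ = (m : ℝ)}

/-- `S` is 2-locally (Worpitzky-)compatible: for every codimension-two flat `X` with
`Φ_X` irreducible, the localization `S ∩ Φ⁺_X` is Worpitzky-compatible in `Φ_X`,
inside the two-dimensional span of `Φ_X`, with respect to `Δ_X`. -/
def TwoLocallyCompat (rs : RootSystemData ℓ) (S : Set (EucV ℓ)) : Prop :=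
  ∀ X : Set (EucV ℓ), rs.IsCodim2Flat X → IrredSet (rs.locΦ X) →
    WCompat (rs.locSpan X) (rs.locPos X) (rs.locΔ X) (S ∩ rs.locPos X)

/-- `S` is 2-locally simple: for every codimension-two flat `X` with `Φ_X`
irreducible, either `S ∩ Φ⁺_X` contains a simple root of `Φ_X` or it is empty. -/
def TwoLocallySimple (rs : RootSystemData ℓ) (S : Set (EucV ℓ)) : Prop :=
  ∀ X : Set (EucV ℓ), rs.IsCodim2Flat X → IrredSet (rs.locΦ X) →
    ((S ∩ rs.locPos X) ∩ rs.locΔ X).Nonempty ∨ S ∩ rs.locPos X = ∅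

/-- `S` is negatively coclosed in the positive system `P`. -/
def NegCoclosed (P S : Set (EucV ℓ)) : Prop :=
  ∀ α ∈ S, ∀ β₁ ∈ P, ∀ β₂ ∈ P, ∀ d₁ d₂ : ℤ, 0 < d₁ → 0 < d₂ →
    α = (d₁ : ℝ) • β₁ + (d₂ : ℝ) • β₂ → ⟪β₁, β₂⟫_ℝ < 0 → β₁ ∈ S ∨ β₂ ∈ S

/-- `S` is coclosed in the positive system `P`. -/
def Coclosed (P S : Set (EucV ℓ)) : Prop :=
  ∀ α ∈ S, ∀ β₁ ∈ P, ∀ β₂ ∈ P, ∀ d₁ d₂ : ℤ, 0 < d₁ → 0 < d₂ →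
    α = (d₁ : ℝ) • β₁ + (d₂ : ℝ) • β₂ → β₁ ∈ S ∨ β₂ ∈ S

/-- The root order: `β ≤ γ` iff `γ - β` is a nonnegative integer combination of the
simple roots in `D`. -/
def rootLE (D : Set (EucV ℓ)) (β γ : EucV ℓ) : Prop := IsNNIntComb D (γ - β)

/-- The defining recursion (on `Φ⁺`) for the function `r` of Lemma 3.8, with respect
to `Δ_X = {γ₁, γ₂}`:
(i) `r β = 1` if `β ∈ Δ` or `β ≤ γ₁` or `β ≤ γ₂`;
(ii) if `β ∉ Δ`, `β ≰ γ₁`, `β ≰ γ₂` and `β - γᵢ ∈ Φ⁺` for `i = 1` or `2`, then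
`r β = r (β - γᵢ) + 1`;
(iii) otherwise `r β = max { r (β - α) : α ∈ Δ, β - α ∈ Φ⁺ }`. -/
def AddrSpec (rs : RootSystemData ℓ) (γ₁ γ₂ : EucV ℓ) (r : EucV ℓ → ℤ) : Prop :=
  (∀ β ∈ rs.Pos, (β ∈ rs.Δ ∨ rootLE rs.Δ β γ₁ ∨ rootLE rs.Δ β γ₂) → r β = 1) ∧
  (∀ β ∈ rs.Pos, β ∉ rs.Δ → ¬ rootLE rs.Δ β γ₁ → ¬ rootLE rs.Δ β γ₂ →
    ((β - γ₁ ∈ rs.Pos → r β = r (β - γ₁) + 1) ∧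
     (β - γ₂ ∈ rs.Pos → r β = r (β - γ₂) + 1))) ∧
  (∀ β ∈ rs.Pos, β ∉ rs.Δ → ¬ rootLE rs.Δ β γ₁ → ¬ rootLE rs.Δ β γ₂ →
    β - γ₁ ∉ rs.Pos → β - γ₂ ∉ rs.Pos →
    ∃ α ∈ rs.Δ, β - α ∈ rs.Pos ∧ r β = r (β - α) ∧
      ∀ α' ∈ rs.Δ, β - α' ∈ rs.Pos → r (β - α') ≤ r (β - α))

/-! ### Positive systems: abstract setting -/

open Filter Topology

/-- The abstract properties of a positive system used below. -/
structure PS (U : Submodule ℝ (EucV ℓ)) (P : Set (EucV ℓ)) : Prop where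
  fin : P.Finite
  sub : ∀ γ ∈ P, γ ∈ U
  ht : ∃ ρ ∈ U, ∀ γ ∈ P, 0 < ⟪γ, ρ⟫_ℝ
  diff : ∀ α ∈ P, ∀ β ∈ P, α ≠ β → 0 < ⟪α, β⟫_ℝ → α - β ∈ P ∨ β - α ∈ P
  red : ∀ β ∈ P, ∀ γ ∈ P, ∀ t : ℝ, γ = t • β → γ = β

/-- The members of `P` taking an integer value at `v`. -/
def Psi (P : Set (EucV ℓ)) (v : EucV ℓ) : Set (EucV ℓ) := {γ ∈ P | ∃ n : ℤ, ⟪γ, v⟫_ℝ = n}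

/-- The pointwise form of compatibility. -/
def LocCond (P S : Set (EucV ℓ)) (v : EucV ℓ) : Prop :=
  ∀ α ∈ S, (∃ n : ℤ, ⟪α, v⟫_ℝ = n) →
    ∃ β ∈ S, β ∈ simplesOf (Psi P v) ∧ α - β ∈ AddSubmonoid.closure (Psi P v)

/-- The open cell with address `r`. -/
def cell (U : Submodule ℝ (EucV ℓ)) (P : Set (EucV ℓ)) (r : EucV ℓ → ℤ) : Set (EucV ℓ) :=
  {x | x ∈ U ∧ ∀ γ ∈ P, (r γ : ℝ) - 1 < ⟪γ, x⟫_ℝ ∧ ⟪γ, x⟫_ℝ < r γ}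

lemma PS.ne_zero {U : Submodule ℝ (EucV ℓ)} {P : Set (EucV ℓ)} (h : PS U P) {γ : EucV ℓ}
    (hγ : γ ∈ P) : γ ≠ 0 := by
  obtain ⟨ρ, -, hρ⟩ := h.ht
  rintro rfl
  simpa using hρ _ hγ

lemma PS.psi {U : Submodule ℝ (EucV ℓ)} {P : Set (EucV ℓ)} (h : PS U P) (v : EucV ℓ) :
    PS U (Psi P v) where
  fin := h.fin.subset fun _ hx => hx.1
  sub γ hγ := h.sub γ hγ.1
  ht := by
    obtain ⟨ρ, hU, hρ⟩ := h.ht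
    exact ⟨ρ, hU, fun γ hγ => hρ γ hγ.1⟩
  diff := by
    rintro α ⟨hα, n, hn⟩ β ⟨hβ, m, hm⟩ hne hpos
    rcases h.diff α hα β hβ hne hpos with h1 | h1
    · exact Or.inl ⟨h1, n - m, by rw [inner_sub_left, hn, hm]; push_cast; ring⟩
    · exact Or.inr ⟨h1, m - n, by rw [inner_sub_left, hn, hm]; push_cast; ring⟩
  red β hβ γ hγ t ht := h.red β hβ.1 γ hγ.1 t ht

lemma PS.closure_simples {U : Submodule ℝ (EucV ℓ)} {P : Set (EucV ℓ)} (h : PS U P) :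
    P ⊆ AddSubmonoid.closure (simplesOf P) := by
  obtain ⟨ρ, -, hρ⟩ := h.ht
  by_contra hc
  rw [Set.not_subset] at hc
  obtain ⟨x, hx, hmin⟩ := Set.exists_min_image
    {x | x ∈ P ∧ x ∉ (AddSubmonoid.closure (simplesOf P) : Set (EucV ℓ))} (fun x => ⟪x, ρ⟫_ℝ)
    (h.fin.subset fun _ hx => hx.1) hc
  have hns : x ∉ simplesOf P := fun hs => hx.2 (AddSubmonoid.subset_closure hs)
  have : ∃ β ∈ P, ∃ γ ∈ P, x = β + γ := by
    by_contra hcon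
    exact hns ⟨hx.1, hcon⟩
  obtain ⟨β, hβ, γ, hγ, rfl⟩ := this
  have h1 : β ∈ AddSubmonoid.closure (simplesOf P) := by
    by_contra hn
    have := hmin β ⟨hβ, hn⟩
    simp only [inner_add_left] at this
    linarith [hρ γ hγ]
  have h2 : γ ∈ AddSubmonoid.closure (simplesOf P) := by
    by_contra hn
    have := hmin γ ⟨hγ, hn⟩
    simp only [inner_add_left] at this
    linarith [hρ β hβ]
  exact hx.2 (add_mem h1 h2)

lemma exists_inner_rep (f : Module.Dual ℝ (EucV ℓ)) (U : Submodule ℝ (EucV ℓ)) :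
    ∃ y ∈ U, ∀ x ∈ U, ⟪x, y⟫_ℝ = f x := by
  let g := LinearMap.toContinuousLinearMap f
  let z := (InnerProductSpace.toDual ℝ (EucV ℓ)).symm g
  refine ⟨U.orthogonalProjectionOnto z, Submodule.coe_mem _, fun x hx => ?_⟩
  have := Submodule.inner_orthogonalProjectionOnto_eq_of_mem_left (K := U) ⟨x, hx⟩ z
  rw [Submodule.coe_inner] at this
  simp only at this
  rw [this, real_inner_comm, InnerProductSpace.toDual_symm_apply]
  rfl

lemma exists_dual_vec {U : Submodule ℝ (EucV ℓ)} {D : Set (EucV ℓ)}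
    (hU : ∀ d ∈ D, d ∈ U) (hli : LinearIndependent ℝ (fun a : D => (a : EucV ℓ)))
    {d : EucV ℓ} (hd : d ∈ D) :
    ∃ y ∈ U, ⟪d, y⟫_ℝ = 1 ∧ ∀ d' ∈ D, d' ≠ d → ⟪d', y⟫_ℝ = 0 := by
  classical
  let b := Module.Basis.span hli
  let f0 := b.coord ⟨d, hd⟩
  obtain ⟨f, hf⟩ := LinearMap.exists_extend f0
  have key : ∀ x (hx : x ∈ D), f x = if x = d then 1 else 0 := by
    intro x hx
    have e : ((b ⟨x, hx⟩ : _) : EucV ℓ) = x := by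
      simp only [b]
      rw [Module.Basis.span_apply]
    have h1 : f x = f0 (b ⟨x, hx⟩) := by
      rw [← hf]; simp [e]
    rw [h1]
    simp [f0, Finsupp.single_apply]
  obtain ⟨y, hy, hxy⟩ := exists_inner_rep f U
  refine ⟨y, hy, ?_, fun d' hd' hne => ?_⟩
  · rw [hxy d (hU d hd), key d hd]; simp
  · rw [hxy d' (hU d' hd'), key d' hd']; simp [hne]

lemma PS.simples_indep {U : Submodule ℝ (EucV ℓ)} {P : Set (EucV ℓ)} (h : PS U P) :
    LinearIndependent ℝ (fun a : simplesOf P => (a : EucV ℓ)) := by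
  obtain ⟨ρ, -, hρ⟩ := h.ht
  refine LinearMap.BilinForm.linearIndependent_of_pairwise_le_zero (innerₗ (EucV ℓ)) ?_
    (innerₗ (EucV ℓ) ρ) _ ?_ ?_
  · intro x hx
    have : 0 < ‖x‖ ^ 2 := by positivity
    simpa [LinearMap.BilinMap.toQuadraticMap_apply] using this
  · rintro ⟨a, ha⟩
    simpa [real_inner_comm] using hρ a ha.1
  · rintro ⟨a, ha⟩ ⟨b, hb⟩ hne
    simp only [innerₗ_apply_apply]
    by_contra hc
    push Not at hc
    have hne' : a ≠ b := fun e => hne (Subtype.ext e)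
    rcases h.diff a ha.1 b hb.1 hne' hc with h1 | h1
    · exact ha.2 ⟨b, hb.1, a - b, h1, by abel⟩
    · exact hb.2 ⟨a, ha.1, b - a, h1, by abel⟩

lemma PS.simples_dual {U : Submodule ℝ (EucV ℓ)} {P : Set (EucV ℓ)} (h : PS U P)
    {β : EucV ℓ} (hβ : β ∈ simplesOf P) :
    ∃ y ∈ U, ⟪β, y⟫_ℝ = 1 ∧ ∀ b ∈ simplesOf P, b ≠ β → ⟪b, y⟫_ℝ = 0 :=
  exists_dual_vec (fun d hd => h.sub d hd.1) h.simples_indep hβ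

/-! ### Cells and alcoves -/

lemma small_lt {a c : ℝ} (b : ℝ) (h : a < c) : ∀ᶠ ε in 𝓝[>] (0 : ℝ), a + ε * b < c := by
  have : ContinuousAt (fun ε : ℝ => a + ε * b) 0 := by fun_prop
  have h2 := this.eventually_lt (continuousAt_const (y := c)) (by simpa using h)
  exact h2.filter_mono nhdsWithin_le_nhds

lemma small_gt {a c : ℝ} (b : ℝ) (h : c < a) : ∀ᶠ ε in 𝓝[>] (0 : ℝ), c < a + ε * b := by
  have : ContinuousAt (fun ε : ℝ => a + ε * b) 0 := by fun_prop
  have h2 := (continuousAt_const (y := c)).eventually_lt this (by simpa using h)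
  exact h2.filter_mono nhdsWithin_le_nhds

lemma exists_small {P : Set (EucV ℓ)} (hP : P.Finite) {p : EucV ℓ → ℝ → Prop}
    (h : ∀ γ ∈ P, ∀ᶠ ε in 𝓝[>] (0 : ℝ), p γ ε) : ∃ ε : ℝ, 0 < ε ∧ ε < 1 ∧ ∀ γ ∈ P, p γ ε := by
  have h1 := (Filter.eventually_all_finite hP).2 h
  have h2 : ∀ᶠ ε in 𝓝[>] (0 : ℝ), ε < 1 := by
    filter_upwards [Ioo_mem_nhdsGT (show (0 : ℝ) < 1 by norm_num)] with ε hε using hε.2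
  obtain ⟨ε, ⟨h3, h4⟩, h5⟩ := ((h1.and h2).and self_mem_nhdsWithin).exists
  exact ⟨ε, h5, h4, h3⟩

lemma cell_disj {U : Submodule ℝ (EucV ℓ)} {P : Set (EucV ℓ)} {r : EucV ℓ → ℤ} :
    cell U P r ⊆ (U : Set (EucV ℓ)) \ hypUnion U P := by
  rintro x ⟨hU, hx⟩
  refine ⟨hU, ?_⟩
  rintro ⟨-, γ, hγ, n, hn⟩
  obtain ⟨h1, h2⟩ := hx γ hγ
  rw [hn] at h1 h2
  have h3 : n < r γ := by exact_mod_cast h2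
  have h4 : r γ - 1 < n := by exact_mod_cast h1
  omega

lemma cell_convex (U : Submodule ℝ (EucV ℓ)) (P : Set (EucV ℓ)) (r : EucV ℓ → ℤ) :
    Convex ℝ (cell U P r) := by
  intro x hx y hy a b ha hb hab
  refine ⟨U.add_mem (U.smul_mem _ hx.1) (U.smul_mem _ hy.1), fun γ hγ => ?_⟩
  simp only [inner_add_right, inner_smul_right]
  obtain ⟨h1, h2⟩ := hx.2 γ hγ
  obtain ⟨h3, h4⟩ := hy.2 γ hγ
  have e : b = 1 - a := by linarith
  subst e
  rcases ha.eq_or_lt with rfl | ha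
  · constructor <;> linarith
  · constructor
    · nlinarith
    · nlinarith

lemma component_eq {U : Submodule ℝ (EucV ℓ)} {P : Set (EucV ℓ)} {r : EucV ℓ → ℤ} {x : EucV ℓ}
    (hx : x ∈ cell U P r) :
    connectedComponentIn ((U : Set (EucV ℓ)) \ hypUnion U P) x = cell U P r := by
  apply Set.Subset.antisymm
  · intro y hy
    have hsub := connectedComponentIn_subset ((U : Set (EucV ℓ)) \ hypUnion U P) x
    refine ⟨(hsub hy).1, fun γ hγ => ?_⟩
    have hpre : IsPreconnected (connectedComponentIn ((U : Set (EucV ℓ)) \ hypUnion U P) x) :=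
      isPreconnected_connectedComponentIn
    have him := (hpre.image (fun z => ⟪γ, z⟫_ℝ) (by fun_prop)).ordConnected
    have hxm : x ∈ connectedComponentIn ((U : Set (EucV ℓ)) \ hypUnion U P) x :=
      mem_connectedComponentIn (cell_disj hx)
    have hno : ∀ n : ℤ, (n : ℝ) ∉
        (fun z => ⟪γ, z⟫_ℝ) '' (connectedComponentIn ((U : Set (EucV ℓ)) \ hypUnion U P) x) := by
      rintro n ⟨z, hz, hzn⟩
      exact (hsub hz).2 ⟨(hsub hz).1, γ, hγ, n, hzn⟩
    obtain ⟨h1, h2⟩ := hx.2 γ hγ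
    constructor
    · by_contra hc
      push Not at hc
      apply hno (r γ - 1)
      apply him.out ⟨y, hy, rfl⟩ ⟨x, hxm, rfl⟩
      push_cast
      exact ⟨hc, h1.le⟩
    · by_contra hc
      push Not at hc
      apply hno (r γ)
      exact him.out ⟨x, hxm, rfl⟩ ⟨y, hy, rfl⟩ ⟨h2.le, hc⟩
  · exact (cell_convex U P r).isPreconnected.subset_connectedComponentIn hx cell_disj

lemma alcove_eq {U : Submodule ℝ (EucV ℓ)} {P A : Set (EucV ℓ)} {r : EucV ℓ → ℤ}
    (hA : IsAlcove U P A) (hr : IsAddress P A r) : A = cell U P r ∧ A.Nonempty := by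
  obtain ⟨x, hx, rfl⟩ := hA
  have hxm := mem_connectedComponentIn hx
  exact ⟨component_eq ⟨hx.1, fun γ hγ => hr γ hγ x hxm⟩, x, hxm⟩

lemma mem_closure_cell {U : Submodule ℝ (EucV ℓ)} {P : Set (EucV ℓ)} {r : EucV ℓ → ℤ}
    (hne : (cell U P r).Nonempty) (x : EucV ℓ) : x ∈ closure (cell U P r) ↔
      x ∈ U ∧ ∀ γ ∈ P, (r γ : ℝ) - 1 ≤ ⟪γ, x⟫_ℝ ∧ ⟪γ, x⟫_ℝ ≤ r γ := by
  constructor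
  · intro hx
    constructor
    · have hcl : IsClosed (U : Set (EucV ℓ)) := U.closed_of_finiteDimensional
      exact closure_minimal (fun y hy => hy.1) hcl hx
    · intro γ hγ
      have hcl : IsClosed {y : EucV ℓ | (r γ : ℝ) - 1 ≤ ⟪γ, y⟫_ℝ ∧ ⟪γ, y⟫_ℝ ≤ r γ} :=
        IsClosed.and (isClosed_le continuous_const (by fun_prop))
          (isClosed_le (by fun_prop) continuous_const)
      exact closure_minimal
        (fun y hy => show _ ∧ _ from ⟨(hy.2 γ hγ).1.le, (hy.2 γ hγ).2.le⟩) hcl hx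
  · rintro ⟨hU, hx⟩
    obtain ⟨a, ha⟩ := hne
    have ht : Tendsto (fun ε : ℝ => x + ε • (a - x)) (𝓝[>] 0) (𝓝 x) := by
      have : ContinuousAt (fun ε : ℝ => x + ε • (a - x)) 0 := by fun_prop
      have h2 := this.tendsto
      simp only [zero_smul, add_zero] at h2
      exact h2.mono_left nhdsWithin_le_nhds
    refine mem_closure_of_tendsto ht ?_
    filter_upwards [Ioo_mem_nhdsGT (show (0 : ℝ) < 1 by norm_num)] with ε hε
    refine ⟨U.add_mem hU (U.smul_mem _ (U.sub_mem ha.1 hU)), fun γ hγ => ?_⟩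
    obtain ⟨h1, h2⟩ := hx γ hγ
    obtain ⟨h3, h4⟩ := ha.2 γ hγ
    obtain ⟨h5, h6⟩ := hε
    simp only [inner_add_right, inner_smul_right, inner_sub_right]
    constructor <;> nlinarith

/-! ### The pointwise criterion -/

lemma psi_eq_of_upper {U : Submodule ℝ (EucV ℓ)} {P : Set (EucV ℓ)} {r : EucV ℓ → ℤ}
    (hne : (cell U P r).Nonempty) {v : EucV ℓ} (hv : v ∈ upperClos P (cell U P r) r)
    {γ : EucV ℓ} (hγ : γ ∈ Psi P v) : ⟪γ, v⟫_ℝ = r γ := by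
  obtain ⟨hγP, n, hn⟩ := hγ
  have h1 := hv.2 γ hγP
  have h2 := (((mem_closure_cell hne v).1 hv.1).2 γ hγP).2
  rw [hn] at h1 h2 ⊢
  have h3 : n ≤ r γ := by exact_mod_cast h2
  have h4 : r γ - 1 < n := by exact_mod_cast h1
  have : n = r γ := by omega
  rw [this]

lemma lt_of_notMem_psi {U : Submodule ℝ (EucV ℓ)} {P : Set (EucV ℓ)} {r : EucV ℓ → ℤ}
    (hne : (cell U P r).Nonempty) {v : EucV ℓ} (hv : v ∈ upperClos P (cell U P r) r)
    {γ : EucV ℓ} (hγ : γ ∈ P) (hn : γ ∉ Psi P v) : ⟪γ, v⟫_ℝ < r γ := by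
  have h2 := (((mem_closure_cell hne v).1 hv.1).2 γ hγ).2
  exact lt_of_le_of_ne h2 fun e => hn ⟨hγ, r γ, e⟩

lemma facet {U : Submodule ℝ (EucV ℓ)} {P : Set (EucV ℓ)} (hP : PS U P) {r : EucV ℓ → ℤ}
    (hne : (cell U P r).Nonempty) {v : EucV ℓ} (hv : v ∈ upperClos P (cell U P r) r)
    {β : EucV ℓ} (hβ : β ∈ simplesOf (Psi P v)) : IsWall U β (r β) (cell U P r) := by
  have hΨ := hP.psi v
  have hvU : v ∈ U := ((mem_closure_cell hne v).1 hv.1).1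
  obtain ⟨ω, hωU, hω1, hω0⟩ := hΨ.simples_dual hβ
  obtain ⟨ρ, hρU, hρ⟩ := hΨ.ht
  set z : EucV ℓ := ⟪β, ρ⟫_ℝ • ω - ρ with hz
  have hzU : z ∈ U := U.sub_mem (U.smul_mem _ hωU) hρU
  have hzβ : ⟪β, z⟫_ℝ = 0 := by
    simp [hz, inner_sub_right, inner_smul_right, hω1]
  have hcl : ∀ x ∈ AddSubmonoid.closure (simplesOf (Psi P v)),
      (∃ k : ℕ, x = k • β) ∨ ⟪x, z⟫_ℝ < 0 := by
    intro x hx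
    induction hx using AddSubmonoid.closure_induction with
    | mem x hx =>
      by_cases e : x = β
      · exact Or.inl ⟨1, by simp [e]⟩
      · right
        simp only [hz, inner_sub_right, inner_smul_right, hω0 x hx e]
        linarith [hρ x hx.1]
    | zero => exact Or.inl ⟨0, by simp⟩
    | add x y _ _ hx hy =>
      rcases hx with ⟨k, rfl⟩ | hx <;> rcases hy with ⟨l, rfl⟩ | hy
      · exact Or.inl ⟨k + l, by rw [add_smul]⟩
      · right
        rw [inner_add_left, ← Nat.cast_smul_eq_nsmul ℝ, inner_smul_left, hzβ]
        simpa using hy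
      · right
        rw [inner_add_left, ← Nat.cast_smul_eq_nsmul ℝ, inner_smul_left, hzβ]
        simpa using hx
      · right
        rw [inner_add_left]; linarith
  have hneg : ∀ γ ∈ Psi P v, γ ≠ β → ⟪γ, z⟫_ℝ < 0 := by
    intro γ hγ hne
    rcases hcl γ (hΨ.closure_simples hγ) with ⟨k, hk⟩ | h
    · exact absurd (hΨ.red β hβ.1 γ hγ k (by rw [hk, Nat.cast_smul_eq_nsmul])) hne
    · exact h
  obtain ⟨ε, hε0, -, hε⟩ := exists_small (p := fun γ ε =>
      γ ≠ β → (r γ : ℝ) - 1 < ⟪γ, v⟫_ℝ + ε * ⟪γ, z⟫_ℝ ∧ ⟪γ, v⟫_ℝ + ε * ⟪γ, z⟫_ℝ < r γ) hP.fin (by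
    intro γ hγ
    by_cases hm : γ ∈ Psi P v
    · filter_upwards [small_gt ⟪γ, z⟫_ℝ (hv.2 γ hγ), self_mem_nhdsWithin] with ε h1 h2 hne
      refine ⟨h1, ?_⟩
      rw [psi_eq_of_upper ‹_› hv hm]
      have := hneg γ hm hne
      have h2 : 0 < ε := h2
      nlinarith
    · filter_upwards [small_gt ⟪γ, z⟫_ℝ (hv.2 γ hγ),
        small_lt ⟪γ, z⟫_ℝ (lt_of_notMem_psi hne hv hγ hm)] with ε h1 h2 _
      exact ⟨h1, h2⟩)
  set p : EucV ℓ := v + ε • z with hp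
  have hpU : p ∈ U := U.add_mem hvU (U.smul_mem _ hzU)
  have hpβ : ⟪β, p⟫_ℝ = r β := by
    simp only [hp, inner_add_right, inner_smul_right, hzβ, psi_eq_of_upper hne hv hβ.1]
    ring
  have hpγ : ∀ γ ∈ P, γ ≠ β → (r γ : ℝ) - 1 < ⟪γ, p⟫_ℝ ∧ ⟪γ, p⟫_ℝ < r γ := by
    intro γ hγ h
    simpa only [hp, inner_add_right, inner_smul_right] using hε γ hγ h
  intro y hyU hyβ
  obtain ⟨δ, hδ0, -, hδ⟩ := exists_small (p := fun γ ε =>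
      γ ≠ β → (r γ : ℝ) - 1 < ⟪γ, p⟫_ℝ + ε * ⟪γ, y - p⟫_ℝ ∧
        ⟪γ, p⟫_ℝ + ε * ⟪γ, y - p⟫_ℝ < r γ) hP.fin (by
    intro γ hγ
    by_cases e : γ = β
    · exact Eventually.of_forall fun _ h => absurd e h
    · filter_upwards [small_gt ⟪γ, y - p⟫_ℝ (hpγ γ hγ e).1,
        small_lt ⟪γ, y - p⟫_ℝ (hpγ γ hγ e).2] with ε h1 h2 _
      exact ⟨h1, h2⟩)
  have mem_aux : ∀ q : EucV ℓ, q ∈ U → ⟪β, q⟫_ℝ = r β →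
      (∀ γ ∈ P, γ ≠ β → (r γ : ℝ) - 1 < ⟪γ, q⟫_ℝ ∧ ⟪γ, q⟫_ℝ < r γ) →
      q ∈ affineSpan ℝ ({x ∈ (U : Set (EucV ℓ)) | ⟪β, x⟫_ℝ = (r β : ℝ)} ∩
        closure (cell U P r)) := by
    intro q hqU hqβ hq
    apply subset_affineSpan
    refine ⟨⟨hqU, hqβ⟩, (mem_closure_cell hne q).2 ⟨hqU, fun γ hγ => ?_⟩⟩
    by_cases e : γ = β
    · subst e
      rw [hqβ]
      constructor <;> linarith
    · exact ⟨(hq γ hγ e).1.le, (hq γ hγ e).2.le⟩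
  have h1 := mem_aux p hpU hpβ hpγ
  have h2 := mem_aux (p + δ • (y - p)) (U.add_mem hpU (U.smul_mem _ (U.sub_mem hyU hpU)))
    (by simp only [inner_add_right, inner_smul_right, inner_sub_right, hpβ, hyβ]; ring)
    (by
      intro γ hγ e
      simpa only [inner_add_right, inner_smul_right] using hδ γ hγ e)
  have h3 := AffineMap.lineMap_mem δ⁻¹ h1 h2
  convert h3 using 1
  rw [AffineMap.lineMap_apply]
  simp only [vsub_eq_sub, vadd_eq_add, add_sub_cancel_left, smul_smul,
    inv_mul_cancel₀ hδ0.ne', one_smul, sub_add_cancel]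

lemma wcompat_of_loc {U : Submodule ℝ (EucV ℓ)} {P D S : Set (EucV ℓ)} (hP : PS U P)
    (hgen : P ⊆ AddSubmonoid.closure D) (h : ∀ v ∈ U, LocCond P S v) :
    WCompat U P D S := by
  intro A hA hsub r hr α hα n
  obtain ⟨rfl, hne⟩ := alcove_eq hA hr
  by_cases hemp : upperClos P (cell U P r) r ∩ {x : EucV ℓ | ⟪α, x⟫_ℝ = (n : ℝ)} = ∅
  · exact Or.inl hemp
  right
  obtain ⟨v, hv, hvn⟩ := Set.nonempty_iff_ne_empty.2 hemp
  have hvn : ⟪α, v⟫_ℝ = n := hvn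
  have hvU : v ∈ U := ((mem_closure_cell hne v).1 hv.1).1
  obtain ⟨β, hβS, hβ, hαβ⟩ := h v hvU α hα ⟨n, hvn⟩
  refine ⟨β, hβS, r β, rfl, ?_, facet hP hne hv hβ, ?_⟩
  · obtain ⟨x, hx⟩ := hne
    have hcl : ∀ y ∈ AddSubmonoid.closure D, y = 0 ∨ 0 < ⟪y, x⟫_ℝ := by
      intro y hy
      induction hy using AddSubmonoid.closure_induction with
      | mem y hy => exact Or.inr ((hsub hx).2 y hy).1
      | zero => exact Or.inl rfl
      | add y z _ _ hy hz =>
        rcases hy with rfl | hy <;> rcases hz with rfl | hz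
        · simp
        · simp [hz]
        · simp [hy]
        · right
          rw [inner_add_left]; linarith
    have h1 : 0 < ⟪β, x⟫_ℝ := (hcl β (hgen hβ.1.1)).resolve_left (hP.ne_zero hβ.1.1)
    have h2 := (hx.2 β hβ.1.1).2
    have h3 : (0 : ℝ) < r β := h1.trans h2
    have : 0 < r β := by exact_mod_cast h3
    omega
  · rintro x ⟨hx, hxn⟩
    have hxn : ⟪α, x⟫_ℝ = n := hxn
    have hxc := ((mem_closure_cell hne x).1 hx.1).2
    have hcl : ∀ y ∈ AddSubmonoid.closure (Psi P v), ⟪y, x⟫_ℝ ≤ ⟪y, v⟫_ℝ := by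
      intro y hy
      induction hy using AddSubmonoid.closure_induction with
      | mem y hy =>
        rw [psi_eq_of_upper hne hv hy]
        exact (hxc y hy.1).2
      | zero => simp
      | add y z _ _ hy hz =>
        rw [inner_add_left, inner_add_left]; linarith
    have h1 := hcl _ hαβ
    have h2 := psi_eq_of_upper hne hv hβ.1
    have h3 := (hxc β hβ.1.1).2
    rw [inner_sub_left, inner_sub_left] at h1
    show ⟪β, x⟫_ℝ = r β
    linarith

lemma loc_of_wcompat {U : Submodule ℝ (EucV ℓ)} {P D S : Set (EucV ℓ)} (hP : PS U P)
    (hDP : D ⊆ P) (hD : LinearIndependent ℝ (fun a : D => (a : EucV ℓ)))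
    (hgen : P ⊆ AddSubmonoid.closure D) (hS : S ⊆ P) (h : WCompat U P D S) :
    ∀ v ∈ U, LocCond P S v := by
  classical
  intro w hw
  -- translate into the fundamental parallelepiped
  have hdual : ∀ d : EucV ℓ, ∃ y ∈ U, d ∈ D → ⟪d, y⟫_ℝ = 1 ∧ ∀ d' ∈ D, d' ≠ d → ⟪d', y⟫_ℝ = 0 := by
    intro d
    by_cases hd : d ∈ D
    · obtain ⟨y, hy, h1⟩ := exists_dual_vec (fun d hd => hP.sub d (hDP hd)) hD hd
      exact ⟨y, hy, fun _ => h1⟩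
    · exact ⟨0, U.zero_mem, fun h => absurd h hd⟩
  choose ω hωU hω using hdual
  have hDf : D.Finite := hP.fin.subset hDP
  set k : EucV ℓ → ℤ := fun d => ⌈⟪d, w⟫_ℝ⌉ - 1 with hk
  set v : EucV ℓ := w - ∑ d ∈ hDf.toFinset, (k d : ℝ) • ω d with hv
  have hvU : v ∈ U := U.sub_mem hw (U.sum_mem fun d _ => U.smul_mem _ (hωU d))
  have hdv : ∀ d ∈ D, ⟪d, v⟫_ℝ = ⟪d, w⟫_ℝ - k d := by
    intro d hd
    rw [hv, inner_sub_right, inner_sum]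
    congr 1
    rw [Finset.sum_eq_single d]
    · rw [inner_smul_right, (hω d hd).1, mul_one]
    · intro b hb hne
      rw [inner_smul_right, (hω b (hDf.mem_toFinset.1 hb)).2 d hd (Ne.symm hne), mul_zero]
    · intro hn
      exact absurd (hDf.mem_toFinset.2 hd) hn
  have hint : ∀ x ∈ AddSubmonoid.closure D, ∃ n : ℤ, ⟪x, v⟫_ℝ = ⟪x, w⟫_ℝ + n := by
    intro x hx
    induction hx using AddSubmonoid.closure_induction with
    | mem x hx => exact ⟨-k x, by rw [hdv x hx]; push_cast; ring⟩
    | zero => exact ⟨0, by simp⟩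
    | add x y _ _ hx hy =>
      obtain ⟨a, ha⟩ := hx
      obtain ⟨b, hb⟩ := hy
      exact ⟨a + b, by rw [inner_add_left, inner_add_left, ha, hb]; push_cast; ring⟩
  have hiff : ∀ γ ∈ P, ((∃ n : ℤ, ⟪γ, v⟫_ℝ = n) ↔ ∃ n : ℤ, ⟪γ, w⟫_ℝ = n) := by
    intro γ hγ
    obtain ⟨a, ha⟩ := hint γ (hgen hγ)
    constructor
    · rintro ⟨n, hn⟩
      exact ⟨n - a, by push_cast; linarith⟩
    · rintro ⟨n, hn⟩
      exact ⟨n + a, by push_cast; linarith⟩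
  have hpsi : Psi P w = Psi P v := by
    ext γ
    constructor
    · rintro ⟨h1, h2⟩
      exact ⟨h1, (hiff γ h1).2 h2⟩
    · rintro ⟨h1, h2⟩
      exact ⟨h1, (hiff γ h1).1 h2⟩
  intro α hα hαw
  rw [hpsi]
  obtain ⟨n, hn⟩ := (hiff α (hS hα)).2 hαw
  have hΨ := hP.psi v
  -- the alcove having `v` in its upper closure
  set r : EucV ℓ → ℤ := fun γ => ⌈⟪γ, v⟫_ℝ⌉ with hr
  have hr1 : ∀ γ, (r γ : ℝ) - 1 < ⟪γ, v⟫_ℝ := fun γ => by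
    have := Int.ceil_lt_add_one ⟪γ, v⟫_ℝ
    simp only [hr]; linarith
  have hr2 : ∀ γ, ⟪γ, v⟫_ℝ ≤ r γ := fun γ => Int.le_ceil _
  have hne : (cell U P r).Nonempty := by
    obtain ⟨ρ, hρU, hρ⟩ := hP.ht
    obtain ⟨ε, hε0, -, hε⟩ := exists_small (p := fun γ ε =>
        (r γ : ℝ) - 1 < ⟪γ, v⟫_ℝ + ε * (-⟪γ, ρ⟫_ℝ)) hP.fin
        (fun γ hγ => small_gt _ (hr1 γ))
    refine ⟨v - ε • ρ, U.sub_mem hvU (U.smul_mem _ hρU), fun γ hγ => ?_⟩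
    simp only [inner_sub_right, inner_smul_right]
    constructor
    · linarith [hε γ hγ]
    · have := mul_pos hε0 (hρ γ hγ)
      linarith [hr2 γ]
  have hvup : v ∈ upperClos P (cell U P r) r :=
    ⟨(mem_closure_cell hne v).2 ⟨hvU, fun γ hγ => ⟨(hr1 γ).le, hr2 γ⟩⟩, fun γ _ => hr1 γ⟩
  have halc : IsAlcove U P (cell U P r) := by
    obtain ⟨x, hx⟩ := hne
    exact ⟨x, cell_disj hx, (component_eq hx).symm⟩
  have hpar : cell U P r ⊆ fundPar U D := by
    intro x hx
    refine ⟨hx.1, fun d hd => ?_⟩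
    have hrd : r d = 1 := by
      simp only [hr]
      rw [Int.ceil_eq_iff, hdv d hd]
      have h1 := Int.ceil_lt_add_one ⟪d, w⟫_ℝ
      have h2 := Int.le_ceil ⟪d, w⟫_ℝ
      simp only [hk]
      push_cast
      constructor <;> linarith
    have := hx.2 d (hDP hd)
    rw [hrd] at this
    push_cast at this
    constructor <;> linarith [this.1, this.2]
  rcases h _ halc hpar r (fun γ hγ x hx => hx.2 γ hγ) α hα n with hE | ⟨β, hβS, m, rfl, -, hwall, hsub⟩
  · exact absurd hE (Set.nonempty_iff_ne_empty.1 ⟨v, hvup, hn⟩)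
  have hβv : ⟪β, v⟫_ℝ = r β := hsub ⟨hvup, hn⟩
  have hβΨ : β ∈ Psi P v := ⟨hS hβS, r β, hβv⟩
  have hβB : β ∈ simplesOf (Psi P v) := by
    refine ⟨hβΨ, ?_⟩
    rintro ⟨γ, hγ, γ', hγ', e⟩
    have h1 : ∀ y ∈ U, ⟪β, y⟫_ℝ = r β → ⟪γ, y⟫_ℝ = r γ := by
      intro y hy hyβ
      have h2 := hwall y hy hyβ
      have h3 : ({x ∈ (U : Set (EucV ℓ)) | ⟪β, x⟫_ℝ = (r β : ℝ)} ∩ closure (cell U P r)) ⊆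
          ((AffineSubspace.mk' v (LinearMap.ker (innerₗ (EucV ℓ) γ)) : AffineSubspace ℝ (EucV ℓ)) :
            Set (EucV ℓ)) := by
        rintro x ⟨⟨-, hxβ⟩, hx⟩
        have hxc := ((mem_closure_cell hne x).1 hx).2
        have e1 := (hxc γ hγ.1).2
        have e2 := (hxc γ' hγ'.1).2
        have e3 := psi_eq_of_upper hne hvup hγ
        have e4 := psi_eq_of_upper hne hvup hγ'
        rw [e, inner_add_left] at hxβ
        have e5 : ⟪γ, v⟫_ℝ + ⟪γ', v⟫_ℝ = r β := by rw [← hβv, e, inner_add_left]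
        rw [← e] at hxβ
        rw [SetLike.mem_coe, AffineSubspace.mem_mk', LinearMap.mem_ker, innerₗ_apply_apply,
          vsub_eq_sub, inner_sub_right]
        linarith
      have h4 := affineSpan_le.2 h3 h2
      rw [AffineSubspace.mem_mk', LinearMap.mem_ker, innerₗ_apply_apply,
          vsub_eq_sub, inner_sub_right] at h4
      rw [← psi_eq_of_upper hne hvup hγ]
      linarith
    -- `γ` is proportional to `β`
    have hβ0 : ⟪β, β⟫_ℝ ≠ 0 := by
      simpa using hP.ne_zero hβΨ.1
    set t : ℝ := ⟪γ, β⟫_ℝ / ⟪β, β⟫_ℝ with ht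
    set q : EucV ℓ := γ - t • β with hq
    have hqU : q ∈ U := U.sub_mem (hP.sub γ hγ.1) (U.smul_mem _ (hP.sub β hβΨ.1))
    have hqβ : ⟪β, q⟫_ℝ = 0 := by
      rw [hq, inner_sub_right, inner_smul_right, ht, div_mul_cancel₀ _ hβ0, real_inner_comm]
      ring
    have h5 := h1 (v + q) (U.add_mem hvU hqU) (by rw [inner_add_right, hqβ, hβv, add_zero])
    rw [inner_add_right, psi_eq_of_upper hne hvup hγ] at h5
    have hqγ : ⟪γ, q⟫_ℝ = 0 := by linarith
    have hqq : ⟪q, q⟫_ℝ = 0 := by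
      nth_rewrite 1 [hq]
      rw [inner_sub_left, inner_smul_left, hqγ, hqβ]; simp
    have hq0 : γ - t • β = 0 := by simpa using hqq
    have h6 := hP.red β hβΨ.1 γ hγ.1 t (sub_eq_zero.1 hq0)
    rw [h6] at e
    exact hP.ne_zero hγ'.1 (by simpa using e)
  refine ⟨β, hβS, hβB, ?_⟩
  obtain ⟨y, hyU, hy1, hy0⟩ := hΨ.simples_dual hβB
  have hcl : ∀ x ∈ AddSubmonoid.closure (simplesOf (Psi P v)),
      x ∈ AddSubmonoid.closure (Psi P v) ∧ 0 ≤ ⟪x, y⟫_ℝ ∧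
      (x - β ∈ AddSubmonoid.closure (Psi P v) ∨ ⟪x, y⟫_ℝ = 0) := by
    intro x hx
    induction hx using AddSubmonoid.closure_induction with
    | mem x hx =>
      refine ⟨AddSubmonoid.subset_closure hx.1, ?_⟩
      by_cases e : x = β
      · subst e
        rw [hy1]
        exact ⟨zero_le_one, Or.inl (by simp)⟩
      · rw [hy0 x hx e]
        exact ⟨le_rfl, Or.inr rfl⟩
    | zero => simp
    | add x z _ _ hx hz =>
      obtain ⟨a1, a2, a3⟩ := hx
      obtain ⟨b1, b2, b3⟩ := hz
      rw [inner_add_left]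
      refine ⟨add_mem a1 b1, add_nonneg a2 b2, ?_⟩
      rcases a3 with a3 | a3
      · left
        rw [add_sub_right_comm]
        exact add_mem a3 b1
      · rcases b3 with b3 | b3
        · left
          rw [add_sub_assoc]
          exact add_mem a1 b3
        · right
          rw [a3, b3, add_zero]
  have hαΨ : α ∈ Psi P v := ⟨hS hα, n, hn⟩
  refine (hcl α (hΨ.closure_simples hαΨ)).2.2.resolve_right fun hα0 => ?_
  obtain ⟨ε, hε0, -, hε⟩ := exists_small (p := fun γ ε =>
      (r γ : ℝ) - 1 < ⟪γ, v⟫_ℝ + ε * (-⟪γ, y⟫_ℝ) ∧ ⟪γ, v⟫_ℝ + ε * (-⟪γ, y⟫_ℝ) ≤ r γ) hP.fin (by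
    intro γ hγ
    by_cases hm : γ ∈ Psi P v
    · filter_upwards [small_gt (-⟪γ, y⟫_ℝ) (hr1 γ), self_mem_nhdsWithin] with ε h1 h2
      refine ⟨h1, ?_⟩
      have h3 := (hcl γ (hΨ.closure_simples hm)).2.1
      have h4 : 0 < ε := h2
      have := mul_nonneg h4.le h3
      linarith [hr2 γ]
    · filter_upwards [small_gt (-⟪γ, y⟫_ℝ) (hr1 γ),
        small_lt (-⟪γ, y⟫_ℝ) (lt_of_notMem_psi hne hvup hγ hm)] with ε h1 h2
      exact ⟨h1, h2.le⟩)
  have hxin : ∀ γ, ⟪γ, v - ε • y⟫_ℝ = ⟪γ, v⟫_ℝ + ε * (-⟪γ, y⟫_ℝ) := by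
    intro γ
    rw [inner_sub_right, inner_smul_right]; ring
  have hxup : v - ε • y ∈ upperClos P (cell U P r) r := by
    refine ⟨(mem_closure_cell hne _).2 ⟨U.sub_mem hvU (U.smul_mem _ hyU), fun γ hγ => ?_⟩,
      fun γ hγ => ?_⟩
    · rw [hxin]
      exact ⟨(hε γ hγ).1.le, (hε γ hγ).2⟩
    · rw [hxin]
      exact (hε γ hγ).1
  have h7 : ⟪β, v - ε • y⟫_ℝ = r β := hsub ⟨hxup, by
    show ⟪α, v - ε • y⟫_ℝ = n
    rw [hxin, hα0, hn]; simp⟩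
  rw [hxin, hβv, hy1] at h7
  linarith

/-! ### Root systems -/

lemma closure_of_nnComb {D : Set (EucV ℓ)} {α : EucV ℓ} (h : IsNNIntComb D α) :
    α ∈ AddSubmonoid.closure D := by
  obtain ⟨s, c, hs, rfl⟩ := h
  refine sum_mem fun b hb => ?_
  rw [Nat.cast_smul_eq_nsmul]
  exact nsmul_mem (AddSubmonoid.subset_closure (hs hb)) _

namespace RootSystemData

variable (rs : RootSystemData ℓ)

lemma exists_height : ∃ f : Module.Dual ℝ (EucV ℓ), ∀ γ ∈ rs.Pos, 0 < f γ := by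
  have hli : LinearIndepOn ℝ id rs.Δ := rs.simple_indep
  obtain ⟨f, hf⟩ := Module.exists_dual_forall_apply_eq_one hli
  refine ⟨f, fun γ hγ => ?_⟩
  have hcl : ∀ y ∈ AddSubmonoid.closure rs.Δ, y = 0 ∨ 0 < f y := by
    intro y hy
    induction hy using AddSubmonoid.closure_induction with
    | mem y hy =>
      right
      have := hf y hy
      simp only [id] at this
      rw [this]; exact one_pos
    | zero => exact Or.inl rfl
    | add y z _ _ hy hz =>
      rcases hy with rfl | hy <;> rcases hz with rfl | hz
      · simp
      · simp [hz]
      · simp [hy]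
      · right
        rw [map_add]; linarith
  refine (hcl γ (closure_of_nnComb hγ.2)).resolve_left ?_
  rintro rfl
  exact rs.nonzero hγ.1

lemma pos_diff : ∀ α ∈ rs.Pos, ∀ β ∈ rs.Pos, α ≠ β → 0 < ⟪α, β⟫_ℝ →
    α - β ∈ rs.Pos ∨ β - α ∈ rs.Pos := by
  intro α hα β hβ hne hpos
  have key : α - β ∈ rs.Φ := by
    obtain ⟨n, hn⟩ := rs.cryst β hβ.1 α hα.1
    obtain ⟨m, hm⟩ := rs.cryst α hα.1 β hβ.1
    have hα0 : 0 < ⟪α, α⟫_ℝ := real_inner_self_pos.2 fun e => rs.nonzero (e ▸ hα.1)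
    have hβ0 : 0 < ⟪β, β⟫_ℝ := real_inner_self_pos.2 fun e => rs.nonzero (e ▸ hβ.1)
    have hc := real_inner_comm α β
    have hn0 : 0 < n := by
      by_contra h
      push Not at h
      have h : (n : ℝ) ≤ 0 := by exact_mod_cast h
      nlinarith
    have hm0 : 0 < m := by
      by_contra h
      push Not at h
      have h : (m : ℝ) ≤ 0 := by exact_mod_cast h
      nlinarith
    by_cases hn1 : n = 1
    · have h1 := rs.refl_mem β hβ.1 α hα.1
      rw [hn, hn1] at h1
      rw [Int.cast_one, one_mul, div_self hβ0.ne', one_smul] at h1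
      exact h1
    by_cases hm1 : m = 1
    · have h1 := rs.refl_mem α hα.1 β hβ.1
      rw [hm, hm1] at h1
      have h2 : β - α ∈ rs.Φ := by
        rw [Int.cast_one, one_mul, div_self hα0.ne', one_smul] at h1
        exact h1
      simpa using rs.neg_mem _ h2
    exfalso
    have hn2 : (2 : ℝ) ≤ n := by exact_mod_cast (by omega : 2 ≤ n)
    have hm2 : (2 : ℝ) ≤ m := by exact_mod_cast (by omega : 2 ≤ m)
    have h0 : 0 < ⟪α - β, α - β⟫_ℝ := real_inner_self_pos.2 (sub_ne_zero.2 hne)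
    rw [inner_sub_left, inner_sub_right, inner_sub_right] at h0
    nlinarith
  rcases rs.pos_or_neg _ key with h | h
  · exact Or.inl ⟨key, h⟩
  · right
    rw [neg_sub] at h
    exact ⟨by simpa using rs.neg_mem _ key, h⟩

lemma pos_red : ∀ β ∈ rs.Pos, ∀ γ ∈ rs.Pos, ∀ t : ℝ, γ = t • β → γ = β := by
  intro β hβ γ hγ t ht
  obtain ⟨f, hf⟩ := rs.exists_height
  rcases rs.reduced β hβ.1 t (ht ▸ hγ.1) with rfl | rfl
  · simpa using ht
  · have h1 := hf γ hγ
    have h2 := hf β hβ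
    rw [ht] at h1
    simp at h1
    linarith

lemma pos_ps : PS ⊤ rs.Pos where
  fin := rs.finite.subset fun _ h => h.1
  sub _ _ := Submodule.mem_top
  ht := by
    obtain ⟨f, hf⟩ := rs.exists_height
    obtain ⟨y, hy, h⟩ := exists_inner_rep f ⊤
    exact ⟨y, hy, fun γ hγ => by rw [h γ Submodule.mem_top]; exact hf γ hγ⟩
  diff := rs.pos_diff
  red := rs.pos_red

lemma loc_ps (X : Set (EucV ℓ)) : PS (Submodule.span ℝ (rs.locΦ X)) (rs.locPos X) where
  fin := rs.finite.subset fun _ h => h.1.1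
  sub γ hγ := Submodule.subset_span hγ.2
  ht := by
    obtain ⟨f, hf⟩ := rs.exists_height
    obtain ⟨y, hy, h⟩ := exists_inner_rep f (Submodule.span ℝ (rs.locΦ X))
    exact ⟨y, hy, fun γ hγ => by
      rw [h γ (Submodule.subset_span hγ.2)]; exact hf γ hγ.1⟩
  diff := by
    intro α hα β hβ hne hpos
    rcases rs.pos_diff α hα.1 β hβ.1 hne hpos with h | h
    · exact Or.inl ⟨h, h.1, fun x hx => by
        rw [inner_sub_left, hα.2.2 x hx, hβ.2.2 x hx, sub_zero]⟩
    · exact Or.inr ⟨h, h.1, fun x hx => by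
        rw [inner_sub_left, hα.2.2 x hx, hβ.2.2 x hx, sub_zero]⟩
  red β hβ γ hγ t ht := rs.pos_red β hβ.1 γ hγ.1 t ht

lemma simple_sub_pos : rs.Δ ⊆ rs.Pos := fun d hd =>
  ⟨rs.simple_sub hd, {d}, fun _ => 1, by simpa using hd, by simp⟩

lemma wcompat_iff {S : Set (EucV ℓ)} (hS : S ⊆ rs.Pos) :
    WCompat Set.univ rs.Pos rs.Δ S ↔ ∀ v, LocCond rs.Pos S v := by
  have hgen : rs.Pos ⊆ AddSubmonoid.closure rs.Δ := fun γ hγ => closure_of_nnComb hγ.2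
  rw [← Submodule.top_coe (R := ℝ)]
  constructor
  · intro h v
    exact loc_of_wcompat rs.pos_ps rs.simple_sub_pos rs.simple_indep hgen hS h v Submodule.mem_top
  · intro h
    exact wcompat_of_loc rs.pos_ps hgen fun v _ => h v

lemma loc_wcompat_iff (X : Set (EucV ℓ)) {S : Set (EucV ℓ)} (hS : S ⊆ rs.locPos X) :
    WCompat (rs.locSpan X) (rs.locPos X) (rs.locΔ X) S ↔
      ∀ v ∈ Submodule.span ℝ (rs.locΦ X), LocCond (rs.locPos X) S v := by
  have hgen := (rs.loc_ps X).closure_simples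
  constructor
  · intro h
    exact loc_of_wcompat (rs.loc_ps X) (fun _ h => h.1) (rs.loc_ps X).simples_indep hgen hS h
  · intro h
    exact wcompat_of_loc (rs.loc_ps X) hgen h

lemma exists_generic {X : Set (EucV ℓ)} (hX : rs.IsCodim2Flat X) (u : EucV ℓ) :
    ∃ x ∈ X, ∀ γ ∈ rs.Pos, γ ∉ rs.locΦ X → ¬ ∃ n : ℤ, ⟪γ, u + x⟫_ℝ = n := by
  obtain ⟨α, hα, β, hβ, -, rfl⟩ := hX
  set X : Set (EucV ℓ) := {x : EucV ℓ | ⟪α, x⟫_ℝ = 0 ∧ ⟪β, x⟫_ℝ = 0} with hXdef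
  let W : Submodule ℝ (EucV ℓ) :=
    LinearMap.ker (innerₗ (EucV ℓ) α) ⊓ LinearMap.ker (innerₗ (EucV ℓ) β)
  have hW : ∀ x, x ∈ W ↔ x ∈ X := by
    intro x
    simp [W, hXdef]
  have hTf : {γ | γ ∈ rs.Pos ∧ γ ∉ rs.locΦ X}.Finite := rs.finite.subset fun _ h => h.1.1
  let T := {γ | γ ∈ rs.Pos ∧ γ ∉ rs.locΦ X}
  have : Finite T := hTf
  obtain ⟨x, hxW, hx⟩ := Module.Dual.exists_forall_mem_ne_zero_of_forall_exists W
    (fun γ : T => innerₗ (EucV ℓ) (γ : EucV ℓ)) (by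
      rintro ⟨γ, hγ⟩
      by_contra hc
      push Not at hc
      exact hγ.2 ⟨hγ.1.1, fun x hx => by simpa using hc x ((hW x).2 hx)⟩)
  have hcount : (⋃ γ ∈ T, {t : ℝ | ∃ n : ℤ, ⟪γ, u + t • x⟫_ℝ = n}).Countable := by
    refine hTf.countable.biUnion fun γ hγ => ?_
    refine (Set.countable_range fun n : ℤ => ((n : ℝ) - ⟪γ, u⟫_ℝ) / ⟪γ, x⟫_ℝ).mono ?_
    rintro t ⟨n, hn⟩
    refine ⟨n, ?_⟩
    have h0 : ⟪γ, x⟫_ℝ ≠ 0 := by simpa using hx ⟨γ, hγ⟩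
    rw [inner_add_right, inner_smul_right] at hn
    simp only
    rw [div_eq_iff h0]; linarith
  obtain ⟨t, ht⟩ := (hcount.dense_compl ℝ).nonempty
  refine ⟨t • x, (hW _).1 (W.smul_mem _ hxW), fun γ hγ hn hint => ht ?_⟩
  exact Set.mem_biUnion (show γ ∈ T from ⟨hγ, hn⟩) hint

end RootSystemData

/-- **Theorem (Abe–Tran, Theorem 1.8, (1) ⇔ (2)).**
Let `Φ` be an irreducible crystallographic root system. A subset `Σ ⊆ Φ⁺` is
Worpitzky-compatible if and only if `Σ` is 2-locally compatible. -/
theorem worpitzky_compatible_iff_two_locally_compatible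
    {ℓ : ℕ} (rs : RootSystemData ℓ) (hirr : IrredSet rs.Φ)
    (S : Set (EucV ℓ)) (hS : S ⊆ rs.Pos) :
    WCompat Set.univ rs.Pos rs.Δ S ↔ TwoLocallyCompat rs S := by
  rw [rs.wcompat_iff hS]
  constructor
  · intro h X hX _
    rw [rs.loc_wcompat_iff X Set.inter_subset_right]
    intro u hu α hα hαu
    obtain ⟨x, hxX, hx⟩ := rs.exists_generic hX u
    have hloc : ∀ γ ∈ rs.locΦ X, ⟪γ, u + x⟫_ℝ = ⟪γ, u⟫_ℝ := by
      intro γ hγ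
      rw [inner_add_right, hγ.2 x hxX, add_zero]
    have hpsi : Psi rs.Pos (u + x) = Psi (rs.locPos X) u := by
      ext γ
      constructor
      · rintro ⟨h1, h2⟩
        have h3 : γ ∈ rs.locΦ X := by
          by_contra hn
          exact hx γ h1 hn h2
        rw [hloc γ h3] at h2
        exact ⟨⟨h1, h3⟩, h2⟩
      · rintro ⟨h1, h2⟩
        rw [← hloc γ h1.2] at h2
        exact ⟨h1.1, h2⟩
    obtain ⟨β, hβS, hβ, hαβ⟩ := h (u + x) α hα.1 (by rw [hloc α hα.2.2]; exact hαu)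
    rw [hpsi] at hβ hαβ
    exact ⟨β, ⟨hβS, hβ.1.1⟩, hβ, hαβ⟩
  · intro h v
    by_contra hcon
    unfold LocCond at hcon
    push Not at hcon
    have hΨ := rs.pos_ps.psi v
    obtain ⟨ρ, -, hρ⟩ := hΨ.ht
    obtain ⟨α, ⟨hαS, hαv, hαn⟩, hmin⟩ := Set.exists_min_image
      {α | α ∈ S ∧ (∃ n : ℤ, ⟪α, v⟫_ℝ = n) ∧ ∀ β ∈ S, β ∈ simplesOf (Psi rs.Pos v) →
        α - β ∉ AddSubmonoid.closure (Psi rs.Pos v)} (fun x => ⟪x, ρ⟫_ℝ)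
      (rs.pos_ps.fin.subset fun _ hx => hS hx.1) hcon
    have hαΨ : α ∈ Psi rs.Pos v := ⟨hS hαS, hαv⟩
    have hα0 : 0 < ⟪α, α⟫_ℝ := real_inner_self_pos.2 (hΨ.ne_zero hαΨ)
    have hex : ∃ β ∈ simplesOf (Psi rs.Pos v), 0 < ⟪α, β⟫_ℝ := by
      by_contra hc
      push Not at hc
      have hcl : ∀ x ∈ AddSubmonoid.closure (simplesOf (Psi rs.Pos v)), ⟪α, x⟫_ℝ ≤ 0 := by
        intro x hx
        induction hx using AddSubmonoid.closure_induction with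
        | mem x hx => exact hc x hx
        | zero => simp
        | add x y _ _ hx hy => rw [inner_add_right]; linarith
      linarith [hcl α (hΨ.closure_simples hαΨ)]
    obtain ⟨β, hβ, hαβ⟩ := hex
    have hne : α ≠ β := by
      rintro rfl
      exact hαn α hαS hβ (by simp)
    have hsub : α - β ∈ Psi rs.Pos v := by
      rcases hΨ.diff α hαΨ β hβ.1 hne hαβ with h1 | h1
      · exact h1
      · exact absurd ⟨α, hαΨ, β - α, h1, by abel⟩ hβ.2
    set X : Set (EucV ℓ) := {x : EucV ℓ | ⟪α, x⟫_ℝ = 0 ∧ ⟪β, x⟫_ℝ = 0} with hXdef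
    have hX : rs.IsCodim2Flat X := by
      refine ⟨α, hαΨ.1, β, hβ.1.1, ?_, rfl⟩
      rintro ⟨t, ht⟩
      exact hne (rs.pos_red α hαΨ.1 β hβ.1.1 t ht).symm
    have hαX : α ∈ rs.locΦ X := ⟨hαΨ.1.1, fun x hx => hx.1⟩
    have hβX : β ∈ rs.locΦ X := ⟨hβ.1.1.1, fun x hx => hx.2⟩
    have hsX : α - β ∈ rs.locΦ X := ⟨hsub.1.1, fun x hx => by
      rw [inner_sub_left, hx.1, hx.2, sub_zero]⟩
    have hzero : ∀ c ∈ rs.locΦ X, ⟪α, c⟫_ℝ = 0 → ⟪β, c⟫_ℝ = 0 → False := by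
      intro c hc h1 h2
      have := hc.2 c ⟨h1, h2⟩
      rw [inner_self_eq_zero] at this
      exact rs.nonzero (this ▸ hc.1)
    have hirrX : IrredSet (rs.locΦ X) := by
      rintro ⟨S₁, S₂, ⟨a, ha⟩, ⟨b, hb⟩, hU, horth⟩
      have hα' := hαX
      have hβ' := hβX
      rw [hU] at hα' hβ'
      rcases hα' with h1 | h1 <;> rcases hβ' with h2 | h2
      · exact hzero b (by rw [hU]; exact Or.inr hb) (horth α h1 b hb) (horth β h2 b hb)
      · exact hαβ.ne' (horth α h1 β h2)
      · exact hαβ.ne' (by rw [real_inner_comm]; exact horth β h2 α h1)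
      · exact hzero a (by rw [hU]; exact Or.inl ha)
          (by rw [real_inner_comm]; exact horth a ha α h1)
          (by rw [real_inner_comm]; exact horth a ha β h2)
    have hW := (rs.loc_wcompat_iff X Set.inter_subset_right).1 (h X hX hirrX)
    obtain ⟨u, huU, hu⟩ := exists_inner_rep (innerₗ (EucV ℓ) v) (Submodule.span ℝ (rs.locΦ X))
    have huv : ∀ γ ∈ rs.locΦ X, ⟪γ, u⟫_ℝ = ⟪γ, v⟫_ℝ := by
      intro γ hγ
      rw [hu γ (Submodule.subset_span hγ), innerₗ_apply_apply, real_inner_comm]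
    have hpsub : Psi (rs.locPos X) u ⊆ Psi rs.Pos v := by
      rintro γ ⟨h1, h2⟩
      rw [huv γ h1.2] at h2
      exact ⟨h1.1, h2⟩
    have hpmem : ∀ γ ∈ Psi rs.Pos v, γ ∈ rs.locΦ X → γ ∈ Psi (rs.locPos X) u := by
      rintro γ ⟨h1, h2⟩ h3
      rw [← huv γ h3] at h2
      exact ⟨⟨h1, h3⟩, h2⟩
    obtain ⟨δ, hδS, hδ, hαδ⟩ := hW u huU α ⟨hαS, hαΨ.1, hαX⟩ (by rw [huv α hαX]; exact hαv)
    have hδΨ : δ ∈ Psi rs.Pos v := hpsub hδ.1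
    have hαδ' : α - δ ∈ AddSubmonoid.closure (Psi rs.Pos v) :=
      AddSubmonoid.closure_mono hpsub hαδ
    have hδα : δ ≠ α := by
      rintro rfl
      exact hδ.2 ⟨β, hpmem β hβ.1 hβX, δ - β, hpmem _ hsub hsX, by abel⟩
    have hcl : ∀ x ∈ AddSubmonoid.closure (Psi rs.Pos v), x = 0 ∨ 0 < ⟪x, ρ⟫_ℝ := by
      intro x hx
      induction hx using AddSubmonoid.closure_induction with
      | mem x hx => exact Or.inr (hρ x hx)
      | zero => exact Or.inl rfl
      | add y z _ _ hy hz =>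
        rcases hy with rfl | hy <;> rcases hz with rfl | hz
        · simp
        · simp [hz]
        · simp [hy]
        · right
          rw [inner_add_left]; linarith
    have hlt := (hcl _ hαδ').resolve_left (sub_ne_zero.2 hδα.symm)
    rw [inner_sub_left] at hlt
    have hle := hmin δ ⟨hδS.1, hδΨ.2, fun β' hβ'S hβ' hc => hαn β' hβ'S hβ' (by
      have := add_mem hαδ' hc
      rwa [sub_add_sub_cancel] at this)⟩
    linarith

end
end

section
/- Let Φ be an irreducible crystallographic root system that is not of type G₂. Then a subset Σ ⊆ Φ⁺ is Worpitzky-compatible if and only if Σ is negatively coclosed. -/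
open scoped InnerProductSpace

noncomputable section

variable {ℓ : ℕ}

/-! ### An explicit point of the parallelepiped -/

theorem wc_abs_point {ι : Type*} [Fintype ι] (a c : ι → ℝ)
    (ha : ∀ i, 0 ≤ a i) (hc : ∀ i, 0 ≤ c i)
    (haZ : ∀ i, ∃ n : ℤ, a i = n) (hcZ : ∀ i, ∃ n : ℤ, c i = n)
    (hind : ∃ i j, a i * c j ≠ a j * c i) :
    ∃ x : ι → ℝ, (∀ i, 0 < x i ∧ x i ≤ 1) ∧ (∃ n : ℤ, ∑ i, a i * x i = n) ∧
      (∃ n : ℤ, ∑ i, c i * x i = n) ∧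
      ∀ i, x i = 1 → ∃ p q : ℝ, p * a i + q * c i = 1 ∧
        ∀ m, m ≠ i → p * a m + q * c m = 0 := by
  classical
  obtain ⟨i₁, j₁, hij⟩ := hind
  let T : Finset ι := Finset.univ.filter (fun i => 0 < a i + c i)
  have hT : T.Nonempty := by
    refine ⟨i₁, ?_⟩
    simp only [T, Finset.mem_filter, Finset.mem_univ, true_and]
    by_contra h
    have h1 : a i₁ = 0 := by linarith [ha i₁, hc i₁]
    have h2 : c i₁ = 0 := by linarith [ha i₁, hc i₁]
    apply hij; rw [h1, h2]; ring
  obtain ⟨i0, hi0, hmax⟩ := T.exists_max_image (fun i => a i / (a i + c i)) hT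
  obtain ⟨j0, hj0, hmin⟩ := T.exists_min_image (fun i => a i / (a i + c i)) hT
  simp only [T, Finset.mem_filter, Finset.mem_univ, true_and] at hi0 hj0 hmax hmin
  have h1 : ∀ m, 0 ≤ a i0 * c m - a m * c i0 := by
    intro m
    by_cases hm : 0 < a m + c m
    · have := hmax m hm
      rw [div_le_div_iff₀ hm hi0] at this
      nlinarith
    · have e1 : a m = 0 := by linarith [ha m, hc m]
      have e2 : c m = 0 := by linarith [ha m, hc m]
      rw [e1, e2]; simp
  have h2 : ∀ m, 0 ≤ a m * c j0 - a j0 * c m := by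
    intro m
    by_cases hm : 0 < a m + c m
    · have := hmin m hm
      rw [div_le_div_iff₀ hj0 hm] at this
      nlinarith
    · have e1 : a m = 0 := by linarith [ha m, hc m]
      have e2 : c m = 0 := by linarith [ha m, hc m]
      rw [e1, e2]; simp
  set D := a i0 * c j0 - a j0 * c i0 with hD
  have hDpos : 0 < D := by
    rcases (h1 j0).lt_or_eq with h | h
    · exact h
    exfalso
    -- all minors vanish
    have h0 : ∀ m, a i0 * c m - a m * c i0 = 0 := by
      intro m
      have k1 := h1 m
      have k2 := h2 m
      have e1 : (a j0 + c j0) * (a i0 * c m - a m * c i0)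
          = - ((a i0 + c i0) * (a m * c j0 - a j0 * c m)) := by
        linear_combination (a m + c m) * h.symm
      have : (a j0 + c j0) * (a i0 * c m - a m * c i0) ≤ 0 := by
        rw [e1]; have := mul_nonneg hi0.le k2; linarith
      by_contra hne
      have : 0 < a i0 * c m - a m * c i0 := lt_of_le_of_ne k1 (Ne.symm hne)
      have := mul_pos hj0 this
      linarith
    have e : (a i0 + c i0) * (a i₁ * c j₁ - a j₁ * c i₁) = 0 := by
      linear_combination (a i₁ + c i₁) * h0 j₁ - (a j₁ + c j₁) * h0 i₁
    rcases mul_eq_zero.1 e with h | h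
    · linarith
    · exact hij (by linarith)
  have hne : i0 ≠ j0 := by
    rintro rfl
    simp [hD] at hDpos
  set s : ι → ℝ := fun m => (a m * c j0 - a j0 * c m) / D with hs
  set t : ι → ℝ := fun m => (a i0 * c m - a m * c i0) / D with ht
  have hs0 : ∀ m, 0 ≤ s m := fun m => div_nonneg (h2 m) hDpos.le
  have ht0 : ∀ m, 0 ≤ t m := fun m => div_nonneg (h1 m) hDpos.le
  have hsi : s i0 = 1 := by simp only [hs]; exact div_self hDpos.ne'
  have htj : t j0 = 1 := by simp only [ht]; exact div_self hDpos.ne'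
  have hsj : s j0 = 0 := by simp [hs]
  have hti : t i0 = 0 := by simp [ht]
  have hat : ∀ m, a m = s m * a i0 + t m * a j0 := by
    intro m; simp only [hs, ht]; field_simp; rw [hD]; ring
  have hct : ∀ m, c m = s m * c i0 + t m * c j0 := by
    intro m; simp only [hs, ht]; field_simp; rw [hD]; ring
  set σ := ∑ m, s m with hσ
  set τ := ∑ m, t m with hτ
  have hσ1 : 1 ≤ σ := by
    rw [← hsi]; exact Finset.single_le_sum (fun m _ => hs0 m) (Finset.mem_univ i0)
  have hτ1 : 1 ≤ τ := by
    rw [← htj]; exact Finset.single_le_sum (fun m _ => ht0 m) (Finset.mem_univ j0)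
  set ε : ℝ := 1 / (σ + τ) with hε
  have hεpos : 0 < ε := by positivity
  have hε1 : ε * (σ + τ) = 1 := by rw [hε]; field_simp
  have hεσ : ε * σ < 1 := by nlinarith
  have hετ : ε * τ < 1 := by nlinarith
  have hεlt : ε < 1 := by nlinarith
  let x : ι → ℝ := fun m => ε + (if m = i0 then 1 - ε * σ else 0) + (if m = j0 then 1 - ε * τ else 0)
  have hsum : ∀ f : ι → ℝ, ∑ m, f m * x m = ε * ∑ m, f m + f i0 * (1 - ε * σ) + f j0 * (1 - ε * τ) := by
    intro f
    simp only [x, mul_add, Finset.sum_add_distrib, Finset.mul_sum, mul_ite, mul_zero,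
      Finset.sum_ite_eq', Finset.mem_univ, if_true]
    simp only [mul_comm]
  have hxs : ∑ m, s m * x m = 1 := by rw [hsum, hsi, hsj]; ring
  have hxt : ∑ m, t m * x m = 1 := by rw [hsum, hti, htj]; ring
  refine ⟨x, ?_, ?_, ?_, ?_⟩
  · intro m
    by_cases e1 : m = i0
    · subst e1
      simp only [x, if_true, hne, if_false]
      constructor <;> nlinarith
    · by_cases e2 : m = j0
      · subst e2
        simp only [x, if_true, e1, if_false]
        constructor <;> nlinarith
      · simp only [x, e1, e2, if_false]
        constructor <;> linarith
  · obtain ⟨n1, hn1⟩ := haZ i0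
    obtain ⟨n2, hn2⟩ := haZ j0
    refine ⟨n1 + n2, ?_⟩
    push_cast
    rw [← hn1, ← hn2]
    calc ∑ m, a m * x m = ∑ m, (s m * a i0 + t m * a j0) * x m := by
          refine Finset.sum_congr rfl fun m _ => ?_
          rw [← hat m]
      _ = a i0 * ∑ m, s m * x m + a j0 * ∑ m, t m * x m := by
          rw [Finset.mul_sum, Finset.mul_sum, ← Finset.sum_add_distrib]
          exact Finset.sum_congr rfl fun m _ => by ring
      _ = _ := by rw [hxs, hxt]; ring
  · obtain ⟨n1, hn1⟩ := hcZ i0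
    obtain ⟨n2, hn2⟩ := hcZ j0
    refine ⟨n1 + n2, ?_⟩
    push_cast
    rw [← hn1, ← hn2]
    calc ∑ m, c m * x m = ∑ m, (s m * c i0 + t m * c j0) * x m := by
          refine Finset.sum_congr rfl fun m _ => ?_
          rw [← hct m]
      _ = c i0 * ∑ m, s m * x m + c j0 * ∑ m, t m * x m := by
          rw [Finset.mul_sum, Finset.mul_sum, ← Finset.sum_add_distrib]
          exact Finset.sum_congr rfl fun m _ => by ring
      _ = _ := by rw [hxs, hxt]; ring
  · intro m hm
    by_cases e1 : m = i0
    · subst e1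
      simp only [x, if_true, hne, if_false] at hm
      have hσe : σ = 1 := by
        have : ε * (σ - 1) = 0 := by linarith
        rcases mul_eq_zero.1 this with h | h <;> linarith
      refine ⟨c j0 / D, - a j0 / D, ?_, ?_⟩
      · field_simp; rw [hD]; ring
      · intro k hk
        have hle : s m + s k ≤ σ := by
          rw [← Finset.sum_pair (Ne.symm hk)]
          exact Finset.sum_le_sum_of_subset_of_nonneg (Finset.subset_univ _) (fun i _ _ => hs0 i)
        have : s k = 0 := by linarith [hs0 k]
        rw [← this]; simp only [hs]; field_simp; ring
    · by_cases e2 : m = j0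
      · subst e2
        simp only [x, if_true, e1, if_false] at hm
        have hσe : τ = 1 := by
          have : ε * (τ - 1) = 0 := by linarith
          rcases mul_eq_zero.1 this with h | h <;> linarith
        refine ⟨- c i0 / D, a i0 / D, ?_, ?_⟩
        · field_simp; rw [hD]; ring
        · intro k hk
          have hle : t m + t k ≤ τ := by
            rw [← Finset.sum_pair (Ne.symm hk)]
            exact Finset.sum_le_sum_of_subset_of_nonneg (Finset.subset_univ _) (fun i _ _ => ht0 i)
          have : t k = 0 := by linarith [ht0 k]
          rw [← this]; simp only [ht]; field_simp; ring
      · simp only [x, e1, e2, if_false] at hm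
        linarith


/-! ### Basic facts on the root system -/

namespace RootSystemData

variable {ℓ : ℕ} (rs : RootSystemData ℓ)

theorem wc_inner_self_pos {α : EucV ℓ} (h : α ∈ rs.Φ) : 0 < ⟪α, α⟫_ℝ := by
  apply real_inner_self_pos.2
  rintro rfl
  exact rs.nonzero h

theorem wc_comb_mem_span {D : Set (EucV ℓ)} {α : EucV ℓ} (h : IsNNIntComb D α) :
    α ∈ Submodule.span ℝ D := by
  obtain ⟨s, c, hs, rfl⟩ := h
  exact Submodule.sum_mem _ fun b hb => Submodule.smul_mem _ _ (Submodule.subset_span (hs hb))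

theorem wc_span_simple : Submodule.span ℝ rs.Δ = ⊤ := by
  rw [eq_top_iff, ← rs.spanning, Submodule.span_le]
  intro α hα
  rcases rs.pos_or_neg α hα with h | h
  · exact wc_comb_mem_span h
  · have := Submodule.neg_mem _ (wc_comb_mem_span h)
    simpa using this

def wcBasis : Module.Basis rs.Δ ℝ (EucV ℓ) :=
  Module.Basis.mk rs.simple_indep (by rw [Subtype.range_coe, rs.wc_span_simple])

theorem wcBasis_apply (i : rs.Δ) : rs.wcBasis i = (i : EucV ℓ) := by
  simp [wcBasis]

theorem wc_repr_nat {α : EucV ℓ} (h : IsNNIntComb rs.Δ α) (i : rs.Δ) :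
    ∃ n : ℕ, rs.wcBasis.repr α i = n := by
  classical
  obtain ⟨s, c, hs, rfl⟩ := h
  rw [map_sum, Finsupp.finsetSum_apply]
  have : ∀ b ∈ s, ∃ n : ℕ, rs.wcBasis.repr ((c b : ℝ) • b) i = n := by
    intro b hb
    have e : rs.wcBasis.repr b = Finsupp.single ⟨b, hs hb⟩ 1 := by
      rw [← rs.wcBasis.repr_self, rs.wcBasis_apply]
    rw [map_smul, Finsupp.smul_apply, e, Finsupp.single_apply]
    split_ifs
    · exact ⟨c b, by simp⟩
    · exact ⟨0, by simp⟩
  choose! g hg using this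
  refine ⟨∑ b ∈ s, g b, ?_⟩
  push_cast
  exact Finset.sum_congr rfl hg

theorem wc_neg_notMem {α : EucV ℓ} (h : α ∈ rs.Pos) : -α ∉ rs.Pos := by
  intro h'
  apply rs.nonzero
  have : α = 0 := by
    apply rs.wcBasis.repr.injective
    ext i
    obtain ⟨n, hn⟩ := rs.wc_repr_nat h.2 i
    obtain ⟨m, hm⟩ := rs.wc_repr_nat h'.2 i
    rw [map_neg, Finsupp.neg_apply, hn] at hm
    have h1 : (0 : ℝ) ≤ n := Nat.cast_nonneg _
    have h2 : (0 : ℝ) ≤ m := Nat.cast_nonneg _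
    rw [hn]; simp only [map_zero, Finsupp.coe_zero, Pi.zero_apply]; linarith
  exact this ▸ h.1

theorem wc_pos_or_neg {α : EucV ℓ} (h : α ∈ rs.Φ) : α ∈ rs.Pos ∨ -α ∈ rs.Pos := by
  rcases rs.pos_or_neg α h with h' | h'
  · exact Or.inl ⟨h, h'⟩
  · exact Or.inr ⟨rs.neg_mem α h, h'⟩

theorem wc_exists_coord (f : rs.Δ → ℝ) : ∃ x : EucV ℓ, ∀ i : rs.Δ, ⟪(i : EucV ℓ), x⟫_ℝ = f i := by
  let φ : EucV ℓ →ₗ[ℝ] ℝ := rs.wcBasis.constr ℝ f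
  refine ⟨(InnerProductSpace.toDual ℝ (EucV ℓ)).symm (LinearMap.toContinuousLinearMap φ), ?_⟩
  intro i
  rw [real_inner_comm, InnerProductSpace.toDual_symm_apply]
  have := rs.wcBasis.constr_basis ℝ f i
  rw [rs.wcBasis_apply] at this
  simpa [φ] using this

theorem wc_inner_eq_sum [Fintype rs.Δ] (α x : EucV ℓ) :
    ⟪α, x⟫_ℝ = ∑ i, rs.wcBasis.repr α i * ⟪(i : EucV ℓ), x⟫_ℝ := by
  conv_lhs => rw [← rs.wcBasis.sum_repr α]
  rw [sum_inner]
  refine Finset.sum_congr rfl fun i _ => ?_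
  rw [inner_smul_left, rs.wcBasis_apply]; simp

theorem wc_refl {α β : EucV ℓ} (hα : α ∈ rs.Φ) (hβ : β ∈ rs.Φ) {n : ℝ}
    (hn : 2 * ⟪β, α⟫_ℝ = n * ⟪α, α⟫_ℝ) : β - n • α ∈ rs.Φ := by
  have := rs.refl_mem α hα β hβ
  rwa [hn, mul_div_assoc, div_self (rs.wc_inner_self_pos hα).ne', mul_one] at this

/-- Cartan integers of a pair. -/
theorem wc_cartan {α β : EucV ℓ} (hα : α ∈ rs.Φ) (hβ : β ∈ rs.Φ) :
    ∃ n k : ℤ, 2 * ⟪β, α⟫_ℝ = n * ⟪α, α⟫_ℝ ∧ 2 * ⟪β, α⟫_ℝ = k * ⟪β, β⟫_ℝ ∧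
      0 ≤ n * k ∧ n * k ≤ 4 ∧ (n = 0 ↔ k = 0) := by
  obtain ⟨n, hn⟩ := rs.cryst α hα β hβ
  obtain ⟨k, hk⟩ := rs.cryst β hβ α hα
  rw [real_inner_comm] at hk
  have pa := rs.wc_inner_self_pos hα
  have pb := rs.wc_inner_self_pos hβ
  have e : ((n * k : ℤ) : ℝ) * (⟪α, α⟫_ℝ * ⟪β, β⟫_ℝ) = 4 * ⟪β, α⟫_ℝ ^ 2 := by
    push_cast
    linear_combination (- (2 : ℝ) * ⟪β, α⟫_ℝ) * hk - (k * ⟪β, β⟫_ℝ) * hn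
  have cs : ⟪β, α⟫_ℝ ^ 2 ≤ ⟪α, α⟫_ℝ * ⟪β, β⟫_ℝ := by
    have := real_inner_mul_inner_self_le β α
    nlinarith
  have pp := mul_pos pa pb
  refine ⟨n, k, hn, hk, ?_, ?_, ?_⟩
  · have : (0 : ℝ) ≤ ((n * k : ℤ) : ℝ) := by
      by_contra h
      have := mul_neg_of_neg_of_pos (not_le.1 h) pp
      nlinarith [sq_nonneg ⟪β, α⟫_ℝ]
    exact_mod_cast this
  · have : ((n * k : ℤ) : ℝ) ≤ 4 := by
      by_contra h
      have := mul_lt_mul_of_pos_right (not_le.1 h) pp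
      linarith
    exact_mod_cast this
  · constructor
    · rintro rfl
      have : (k : ℝ) * ⟪β, β⟫_ℝ = 0 := by rw [← hk, hn]; simp
      rcases mul_eq_zero.1 this with h | h
      · exact_mod_cast h
      · exact absurd h pb.ne'
    · rintro rfl
      have : (n : ℝ) * ⟪α, α⟫_ℝ = 0 := by rw [← hn, hk]; simp
      rcases mul_eq_zero.1 this with h | h
      · exact_mod_cast h
      · exact absurd h pa.ne'

end RootSystemData

theorem wc_int_bound {n k : ℤ} (h0 : 0 ≤ n * k) (h4 : n * k ≤ 4) (hz : n = 0 ↔ k = 0) :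
    n ∈ Finset.Icc (-4 : ℤ) 4 ∧ k ∈ Finset.Icc (-4 : ℤ) 4 := by
  by_cases hn : n = 0
  · have := hz.1 hn; subst hn; subst this; decide
  have hk : k ≠ 0 := fun h => hn (hz.2 h)
  simp only [Finset.mem_Icc]
  rcases lt_or_gt_of_ne hn with h | h <;> rcases lt_or_gt_of_ne hk with h' | h' <;>
    refine ⟨⟨?_, ?_⟩, ⟨?_, ?_⟩⟩ <;> nlinarith

theorem wc_int_out : ∀ n ∈ Finset.Icc (-4 : ℤ) 4, ∀ k ∈ Finset.Icc (-4 : ℤ) 4,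
    ∀ m ∈ Finset.Icc (-4 : ℤ) 4, ∀ j ∈ Finset.Icc (-4 : ℤ) 4,
    (n = 0 ↔ k = 0) → (m = 0 ↔ j = 0) →
    n * j = 3 * m * k → ¬ (n = 0 ∧ m = 0) →
    (k = 0 ∨ k * k * (n * n + 3 * n * m + 3 * m * m) < k * n) →
    (j = 0 ∨ j * j * (n * n + 3 * n * m + 3 * m * m) < 3 * m * j) → False := by
  set_option maxRecDepth 100000 in
  decide +kernel

theorem wc_int_in : ∀ n ∈ Finset.Icc (-4 : ℤ) 4, ∀ k ∈ Finset.Icc (-4 : ℤ) 4,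
    ∀ m ∈ Finset.Icc (-4 : ℤ) 4, ∀ j ∈ Finset.Icc (-4 : ℤ) 4,
    ¬ (n = 0 ∧ m = 0) →
    (k * (n * n + 3 * n * m + 3 * m * m) = n) →
    (j * (n * n + 3 * n * m + 3 * m * m) = 3 * m) →
    ((2 * n + 3 * m, n + 2 * m) : ℤ × ℤ) ∈
      ({(1,0),(0,1),(1,1),(2,1),(3,1),(3,2),(-1,0),(0,-1),(-1,-1),(-2,-1),(-3,-1),(-3,-2)} :
        Finset (ℤ × ℤ)) := by
  set_option maxRecDepth 100000 in
  decide +kernel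


namespace RootSystemData

variable {ℓ : ℕ} (rs : RootSystemData ℓ)

theorem wc_g2_data {β₁ β₂ b : EucV ℓ} (h1 : β₁ ∈ rs.Φ) (h2 : β₂ ∈ rs.Φ) (hb : b ∈ rs.Φ)
    (hl : ⟪β₂, β₂⟫_ℝ = 3 * ⟪β₁, β₁⟫_ℝ) (hin : 2 * ⟪β₁, β₂⟫_ℝ = -3 * ⟪β₁, β₁⟫_ℝ) :
    ∃ n ∈ Finset.Icc (-4 : ℤ) 4, ∃ k ∈ Finset.Icc (-4 : ℤ) 4,
    ∃ m ∈ Finset.Icc (-4 : ℤ) 4, ∃ j ∈ Finset.Icc (-4 : ℤ) 4,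
      (n = 0 ↔ k = 0) ∧ (m = 0 ↔ j = 0) ∧ n * j = 3 * m * k ∧
      2 * ⟪b, β₁⟫_ℝ = n * ⟪β₁, β₁⟫_ℝ ∧ 2 * ⟪b, β₂⟫_ℝ = 3 * m * ⟪β₁, β₁⟫_ℝ ∧
      (n : ℝ) * ⟪β₁, β₁⟫_ℝ = k * ⟪b, b⟫_ℝ ∧ 3 * (m : ℝ) * ⟪β₁, β₁⟫_ℝ = j * ⟪b, b⟫_ℝ ∧
      ⟪b - ((2 * n + 3 * m : ℝ) • β₁ + (n + 2 * m : ℝ) • β₂), β₁⟫_ℝ = 0 ∧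
      ⟪b - ((2 * n + 3 * m : ℝ) • β₁ + (n + 2 * m : ℝ) • β₂), β₂⟫_ℝ = 0 ∧
      ⟪b - ((2 * n + 3 * m : ℝ) • β₁ + (n + 2 * m : ℝ) • β₂),
        b - ((2 * n + 3 * m : ℝ) • β₁ + (n + 2 * m : ℝ) • β₂)⟫_ℝ
        = ⟪b, b⟫_ℝ - ⟪β₁, β₁⟫_ℝ * (n * n + 3 * n * m + 3 * m * m) := by
  obtain ⟨n, k, hn, hk, b0, b4, bz⟩ := rs.wc_cartan h1 hb
  obtain ⟨m, j, hm, hj, c0, c4, cz⟩ := rs.wc_cartan h2 hb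
  have ib := wc_int_bound b0 b4 bz
  have ic := wc_int_bound c0 c4 cz
  rw [hl] at hm
  have pL := rs.wc_inner_self_pos h1
  have pN := rs.wc_inner_self_pos hb
  have e21 : ⟪β₂, β₁⟫_ℝ = ⟪β₁, β₂⟫_ℝ := real_inner_comm _ _
  have eb1 : ⟪β₁, b⟫_ℝ = ⟪b, β₁⟫_ℝ := real_inner_comm _ _
  have eb2 : ⟪β₂, b⟫_ℝ = ⟪b, β₂⟫_ℝ := real_inner_comm _ _
  have x1 : ⟪b, β₁⟫_ℝ = n * ⟪β₁, β₁⟫_ℝ / 2 := by linarith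
  have x2 : ⟪b, β₂⟫_ℝ = 3 * m * ⟪β₁, β₁⟫_ℝ / 2 := by linarith
  have x3 : ⟪β₁, β₂⟫_ℝ = -3 * ⟪β₁, β₁⟫_ℝ / 2 := by linarith
  refine ⟨n, ib.1, k, ib.2, m, ic.1, j, ic.2, bz, cz, ?_, hn, by linarith, by linarith,
    by linarith, ?_, ?_, ?_⟩
  · have : ((n * j : ℤ) : ℝ) * (⟪β₁, β₁⟫_ℝ * ⟪b, b⟫_ℝ)
        = ((3 * m * k : ℤ) : ℝ) * (⟪β₁, β₁⟫_ℝ * ⟪b, b⟫_ℝ) := by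
      push_cast
      have y1 : (n : ℝ) * ⟪β₁, β₁⟫_ℝ = k * ⟪b, b⟫_ℝ := by linarith
      have y2 : 3 * (m : ℝ) * ⟪β₁, β₁⟫_ℝ = j * ⟪b, b⟫_ℝ := by linarith
      linear_combination (j * ⟪b, b⟫_ℝ) * y1 - (k * ⟪b, b⟫_ℝ) * y2
    have := mul_right_cancel₀ (mul_pos pL pN).ne' this
    exact_mod_cast this
  · simp only [inner_sub_left, inner_add_left, inner_smul_left, RCLike.conj_to_real, e21, x1, x3]
    ring
  · simp only [inner_sub_left, inner_add_left, inner_smul_left, RCLike.conj_to_real, hl, x2, x3]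
    ring
  · simp only [inner_sub_left, inner_add_left, inner_smul_left, inner_sub_right, inner_add_right,
      inner_smul_right, RCLike.conj_to_real, hl, e21, eb1, eb2, x1, x2, x3]
    ring

theorem wc_card_pos (T : Finset (EucV ℓ)) (hT : rs.Φ = ↑T) (hc : T.card = 12) :
    rs.Pos.ncard = 6 := by
  have hfin : rs.Pos.Finite := rs.finite.subset fun _ h => h.1
  have hU : rs.Φ = rs.Pos ∪ (fun x => -x) '' rs.Pos := by
    ext α
    constructor
    · intro h
      rcases rs.wc_pos_or_neg h with h' | h'
      · exact Or.inl h'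
      · exact Or.inr ⟨-α, h', by simp⟩
    · rintro (h | ⟨β, hβ, rfl⟩)
      · exact h.1
      · exact rs.neg_mem _ hβ.1
  have hd : Disjoint rs.Pos ((fun x => -x) '' rs.Pos) := by
    rw [Set.disjoint_left]
    rintro α h ⟨β, hβ, rfl⟩
    exact rs.wc_neg_notMem hβ h
  have h12 : rs.Φ.ncard = 12 := by rw [hT, Set.ncard_coe_finset, hc]
  rw [hU, Set.ncard_union_eq hd hfin (hfin.image _),
    Set.ncard_image_of_injective _ neg_injective] at h12
  omega

theorem wc_no_g2_aux (hirr : IrredSet rs.Φ) (hG2 : ¬ (ℓ = 2 ∧ rs.Pos.ncard = 6))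
    {β₁ β₂ : EucV ℓ} (h1 : β₁ ∈ rs.Φ) (h2 : β₂ ∈ rs.Φ)
    (hl : ⟪β₂, β₂⟫_ℝ = 3 * ⟪β₁, β₁⟫_ℝ) (hin : 2 * ⟪β₁, β₂⟫_ℝ = -3 * ⟪β₁, β₁⟫_ℝ) : False := by
  classical
  have pL := rs.wc_inner_self_pos h1
  have e21 : ⟪β₂, β₁⟫_ℝ = ⟪β₁, β₂⟫_ℝ := real_inner_comm _ _
  -- linear independence
  have hli : ∀ p q : ℝ, p • β₁ + q • β₂ = 0 → p = 0 ∧ q = 0 := by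
    intro p q h
    have i1 : ⟪p • β₁ + q • β₂, β₁⟫_ℝ = 0 := by rw [h]; simp
    have i2 : ⟪p • β₁ + q • β₂, β₂⟫_ℝ = 0 := by rw [h]; simp
    simp only [inner_add_left, inner_smul_left, RCLike.conj_to_real, e21, hl] at i1 i2
    have x3 : ⟪β₁, β₂⟫_ℝ = -3 * ⟪β₁, β₁⟫_ℝ / 2 := by linarith
    rw [x3] at i1 i2
    have j1 : (p - 3 / 2 * q) * ⟪β₁, β₁⟫_ℝ = 0 := by linarith
    have j2 : (- p + 2 * q) * ⟪β₁, β₁⟫_ℝ = 0 := by linarith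
    have k1 := (mul_eq_zero.1 j1).resolve_right pL.ne'
    have k2 := (mul_eq_zero.1 j2).resolve_right pL.ne'
    constructor <;> linarith
  let W : Submodule ℝ (EucV ℓ) := Submodule.span ℝ {β₁, β₂}
  have hW : ∀ p q : ℝ, p • β₁ + q • β₂ ∈ W := fun p q =>
    Submodule.add_mem _ (Submodule.smul_mem _ _ (Submodule.subset_span (by simp)))
      (Submodule.smul_mem _ _ (Submodule.subset_span (by simp)))
  by_cases hout : ∃ b ∈ rs.Φ, b ∉ W
  · obtain ⟨b0, hb0, hb0W⟩ := hout
    apply hirr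
    refine ⟨{b ∈ rs.Φ | b ∈ W}, {b ∈ rs.Φ | b ∉ W}, ⟨β₁, h1, Submodule.subset_span (by simp)⟩,
      ⟨b0, hb0, hb0W⟩, ?_, ?_⟩
    · ext b; by_cases h : b ∈ W <;> simp [h]
    rintro a ⟨-, haW⟩ b ⟨hb, hbW⟩
    obtain ⟨n, hn, k, hk, m, hm, j, hj, bz, cz, hjk, ei1, ei2, f1, f2, g1, g2, g3⟩ :=
      rs.wc_g2_data h1 h2 hb hl hin
    have pN := rs.wc_inner_self_pos hb
    have hpos : 0 < ⟪b, b⟫_ℝ - ⟪β₁, β₁⟫_ℝ * (n * n + 3 * n * m + 3 * m * m) := by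
      rw [← g3]
      apply real_inner_self_pos.2
      intro h
      apply hbW
      rw [sub_eq_zero.1 h]
      exact hW _ _
    by_cases hz : n = 0 ∧ m = 0
    · obtain ⟨rfl, rfl⟩ := hz
      obtain ⟨p, q, rfl⟩ := Submodule.mem_span_pair.1 haW
      simp only [Int.cast_zero, zero_mul, mul_zero] at ei1 ei2
      rw [inner_add_left, inner_smul_left, inner_smul_left, real_inner_comm, real_inner_comm b β₂]
      have y1 : ⟪b, β₁⟫_ℝ = 0 := by linarith
      have y2 : ⟪b, β₂⟫_ℝ = 0 := by linarith
      rw [y1, y2]; simp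
    · exfalso
      refine wc_int_out n hn k hk m hm j hj bz cz hjk hz ?_ ?_
      · by_cases h0 : k = 0
        · exact Or.inl h0
        right
        have hk2 : (0 : ℝ) < k * k := by
          have : (k : ℝ) ≠ 0 := by exact_mod_cast h0
          exact mul_self_pos.2 this
        have := mul_pos hk2 hpos
        have : 0 < ((k : ℝ) * n - k * k * (n * n + 3 * n * m + 3 * m * m)) * ⟪β₁, β₁⟫_ℝ := by
          linear_combination this - k * f1
        have := (pos_iff_pos_of_mul_pos this).2 pL
        have : (k : ℝ) * k * (n * n + 3 * n * m + 3 * m * m) < k * n := by linarith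
        exact_mod_cast this
      · by_cases h0 : j = 0
        · exact Or.inl h0
        right
        have hk2 : (0 : ℝ) < j * j := by
          have : (j : ℝ) ≠ 0 := by exact_mod_cast h0
          exact mul_self_pos.2 this
        have := mul_pos hk2 hpos
        have : 0 < ((3 : ℝ) * m * j - j * j * (n * n + 3 * n * m + 3 * m * m)) * ⟪β₁, β₁⟫_ℝ := by
          linear_combination this - j * f2
        have := (pos_iff_pos_of_mul_pos this).2 pL
        have : (j : ℝ) * j * (n * n + 3 * n * m + 3 * m * m) < 3 * m * j := by linarith
        exact_mod_cast this
  · push Not at hout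
    apply hG2
    constructor
    · have hWtop : W = ⊤ := by
        rw [eq_top_iff, ← rs.spanning, Submodule.span_le]
        exact hout
      have hli' : LinearIndependent ℝ ![β₁, β₂] := by
        rw [LinearIndependent.pair_iff]
        exact hli
      have hr := finrank_span_eq_card hli'
      have : Set.range ![β₁, β₂] = {β₁, β₂} := by simp [Matrix.range_cons, Set.pair_comm]
      rw [this] at hr
      change Module.finrank ℝ W = _ at hr
      rw [hWtop, finrank_top] at hr
      simpa using hr
    · let f : ℤ × ℤ → EucV ℓ := fun z => (z.1 : ℝ) • β₁ + (z.2 : ℝ) • β₂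
      have hf : Function.Injective f := by
        rintro ⟨p, q⟩ ⟨p', q'⟩ h
        have : ((p : ℝ) - p') • β₁ + ((q : ℝ) - q') • β₂ = 0 := by
          simp only [f] at h
          rw [sub_smul, sub_smul]
          rw [← sub_eq_zero] at h
          rw [← h]; abel
        obtain ⟨u, v⟩ := hli _ _ this
        have u' : (p : ℝ) = p' := by linarith
        have v' : (q : ℝ) = q' := by linarith
        ext
        · exact_mod_cast u'
        · exact_mod_cast v'
      let T0 : Finset (ℤ × ℤ) :=
        {(1,0),(0,1),(1,1),(2,1),(3,1),(3,2),(-1,0),(0,-1),(-1,-1),(-2,-1),(-3,-1),(-3,-2)}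
      refine rs.wc_card_pos (T0.image f) ?_ ?_
      · ext b
        constructor
        · intro hb
          obtain ⟨n, hn, k, hk, m, hm, j, hj, bz, cz, hjk, ei1, ei2, f1, f2, g1, g2, g3⟩ :=
            rs.wc_g2_data h1 h2 hb hl hin
          have hc0 : b - ((2 * n + 3 * m : ℝ) • β₁ + (n + 2 * m : ℝ) • β₂) = 0 := by
            have hcW : b - ((2 * n + 3 * m : ℝ) • β₁ + (n + 2 * m : ℝ) • β₂) ∈ W :=
              Submodule.sub_mem _ (hout b hb) (hW _ _)
            obtain ⟨p, q, hpq⟩ := Submodule.mem_span_pair.1 hcW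
            rw [← inner_self_eq_zero (𝕜 := ℝ)]
            nth_rewrite 2 [← hpq]
            rw [inner_add_right, inner_smul_right, inner_smul_right, g1, g2]; simp
          rw [hc0, inner_zero_left] at g3
          have pN := rs.wc_inner_self_pos hb
          have gN : ⟪b, b⟫_ℝ = ⟪β₁, β₁⟫_ℝ * (n * n + 3 * n * m + 3 * m * m) := by linarith
          have q1 : k * (n * n + 3 * n * m + 3 * m * m) = n := by
            have : ((k : ℝ) * (n * n + 3 * n * m + 3 * m * m)) * ⟪β₁, β₁⟫_ℝ = n * ⟪β₁, β₁⟫_ℝ := by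
              rw [f1, gN]; ring
            exact_mod_cast mul_right_cancel₀ pL.ne' this
          have q2 : j * (n * n + 3 * n * m + 3 * m * m) = 3 * m := by
            have : ((j : ℝ) * (n * n + 3 * n * m + 3 * m * m)) * ⟪β₁, β₁⟫_ℝ
                = (3 * m) * ⟪β₁, β₁⟫_ℝ := by
              rw [f2, gN]; ring
            exact_mod_cast mul_right_cancel₀ pL.ne' this
          have hz : ¬ (n = 0 ∧ m = 0) := by
            rintro ⟨rfl, rfl⟩
            simp at gN
            rw [gN] at pN
            simp at pN
          have := wc_int_in n hn k hk m hm j hj hz q1 q2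
          rw [Finset.coe_image]
          refine ⟨_, this, ?_⟩
          simp only [f]
          rw [sub_eq_zero.1 hc0]
          push_cast
          rfl
        · have x3 : ⟪β₁, β₂⟫_ℝ = -3 * ⟪β₁, β₁⟫_ℝ / 2 := by linarith
          have r1 : β₂ - (-3 : ℝ) • β₁ ∈ rs.Φ := rs.wc_refl h1 h2 (by rw [e21]; linarith)
          have r2 : β₁ - (-1 : ℝ) • β₂ ∈ rs.Φ := rs.wc_refl h2 h1 (by rw [hl]; linarith)
          have r3 : (β₁ - (-1 : ℝ) • β₂) - (-1 : ℝ) • β₁ ∈ rs.Φ := rs.wc_refl h1 r2 (by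
            rw [inner_sub_left, inner_smul_left, e21, x3]; simp; ring)
          have r4 : (β₂ - (-3 : ℝ) • β₁) - (-1 : ℝ) • β₂ ∈ rs.Φ := rs.wc_refl h2 r1 (by
            rw [inner_sub_left, inner_smul_left, hl, x3]; simp; ring)
          rw [Finset.coe_image]
          rintro ⟨z, hz, rfl⟩
          have m1 : f (1, 0) ∈ rs.Φ := by simpa [f] using h1
          have m2 : f (0, 1) ∈ rs.Φ := by simpa [f] using h2
          have m3 : f (1, 1) ∈ rs.Φ := by convert r2 using 1; simp [f]
          have m4 : f (2, 1) ∈ rs.Φ := by convert r3 using 1; simp only [f]; push_cast; module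
          have m5 : f (3, 1) ∈ rs.Φ := by convert r1 using 1; simp only [f]; push_cast; module
          have m6 : f (3, 2) ∈ rs.Φ := by convert r4 using 1; simp only [f]; push_cast; module
          have hneg : ∀ p q : ℤ, f (p, q) ∈ rs.Φ → f (-p, -q) ∈ rs.Φ := by
            intro p q h
            convert rs.neg_mem _ h using 1
            simp only [f]; push_cast; module
          have hz' : z ∈ T0 := hz
          simp only [T0, Finset.mem_insert, Finset.mem_singleton] at hz'
          rcases hz' with rfl | rfl | rfl | rfl | rfl | rfl | rfl | rfl | rfl | rfl | rfl | rfl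
          · exact m1
          · exact m2
          · exact m3
          · exact m4
          · exact m5
          · exact m6
          · exact hneg 1 0 m1
          · exact hneg 0 1 m2
          · exact hneg 1 1 m3
          · exact hneg 2 1 m4
          · exact hneg 3 1 m5
          · exact hneg 3 2 m6
      · rw [Finset.card_image_of_injective _ hf]; decide

/-- No pair of roots of a root system as in the theorem has Cartan product `3`. -/
theorem wc_no_g2 (hirr : IrredSet rs.Φ) (hG2 : ¬ (ℓ = 2 ∧ rs.Pos.ncard = 6))
    {α β : EucV ℓ} (h1 : α ∈ rs.Φ) (h2 : β ∈ rs.Φ) {n k : ℤ}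
    (hn : 2 * ⟪β, α⟫_ℝ = n * ⟪α, α⟫_ℝ) (hk : 2 * ⟪β, α⟫_ℝ = k * ⟪β, β⟫_ℝ) : n * k ≠ 3 := by
  intro h3
  have hc : ⟪α, β⟫_ℝ = ⟪β, α⟫_ℝ := real_inner_comm _ _
  have hd : n ∣ 3 := ⟨k, h3.symm⟩
  have hb1 : n ≤ 3 := Int.le_of_dvd (by norm_num) hd
  have hb2 : -3 ≤ n := by
    have := Int.le_of_dvd (by norm_num) ((neg_dvd).2 hd)
    linarith
  have hcases : (n = 1 ∧ k = 3) ∨ (n = 3 ∧ k = 1) ∨ (n = -1 ∧ k = -3) ∨ (n = -3 ∧ k = -1) := by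
    interval_cases n <;> omega
  rcases hcases with ⟨rfl, rfl⟩ | ⟨rfl, rfl⟩ | ⟨rfl, rfl⟩ | ⟨rfl, rfl⟩ <;> push_cast at hn hk
  · refine rs.wc_no_g2_aux hirr hG2 h2 (rs.neg_mem _ h1) ?_ ?_
    · rw [inner_neg_neg]; linarith
    · rw [inner_neg_right]; linarith
  · refine rs.wc_no_g2_aux hirr hG2 h1 (rs.neg_mem _ h2) ?_ ?_
    · rw [inner_neg_neg]; linarith
    · rw [inner_neg_right]; linarith
  · refine rs.wc_no_g2_aux hirr hG2 h2 h1 ?_ ?_ <;> linarith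
  · refine rs.wc_no_g2_aux hirr hG2 h1 h2 ?_ ?_ <;> linarith

end RootSystemData


theorem wc_int_plane : ∀ n ∈ Finset.Icc (-4 : ℤ) (-1), ∀ k ∈ Finset.Icc (-4 : ℤ) (-1),
    n * k ≤ 2 → ∀ i ∈ Finset.Icc (1 : ℤ) 4, ∀ i' ∈ Finset.Icc (1 : ℤ) 4, i * i' ≤ 4 → i * i' ≠ 3 →
    ∀ j ∈ Finset.Icc (-4 : ℤ) (-1), ∀ j' ∈ Finset.Icc (-4 : ℤ) (-1), j * j' ≤ 4 → j * j' ≠ 3 →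
    n * i' * j = k * j' * i → 0 < 2 * i - n * j → 0 < k * i - 2 * j →
    2 * (4 - n * k) = (2 * i - n * j) * i' - (k * i - 2 * j) * j' → False := by
  set_option maxRecDepth 100000 in
  decide +kernel

namespace RootSystemData

variable {ℓ : ℕ} (rs : RootSystemData ℓ)

theorem wc_collinear {α β : EucV ℓ} (h1 : α ∈ rs.Φ) {n k : ℤ}
    (hn : 2 * ⟪β, α⟫_ℝ = n * ⟪α, α⟫_ℝ) (hk : 2 * ⟪β, α⟫_ℝ = k * ⟪β, β⟫_ℝ) (h4 : n * k = 4) :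
    β = ((n : ℝ) / 2) • α := by
  have pa := rs.wc_inner_self_pos h1
  have h4' : (n : ℝ) * k = 4 := by exact_mod_cast h4
  have hc : ⟪α, β⟫_ℝ = ⟪β, α⟫_ℝ := real_inner_comm _ _
  rw [← sub_eq_zero, ← inner_self_eq_zero (𝕜 := ℝ)]
  simp only [inner_sub_left, inner_sub_right, inner_smul_left, inner_smul_right,
    RCLike.conj_to_real, hc]
  have e1 : ⟪β, α⟫_ℝ = n / 2 * ⟪α, α⟫_ℝ := by linarith
  have e2 : 4 * ⟪β, β⟫_ℝ = n * n * ⟪α, α⟫_ℝ := by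
    rw [← h4']
    linear_combination n * (hn - hk)
  rw [e1]
  linear_combination (1 / 4 : ℝ) * e2

theorem wc_eq_of_smul {α β : EucV ℓ} (h1 : α ∈ rs.Pos) (h2 : β ∈ rs.Pos) {t : ℝ}
    (h : β = t • α) : β = α := by
  rcases rs.reduced α h1.1 t (h ▸ h2.1) with rfl | rfl
  · simpa using h
  · exfalso
    apply rs.wc_neg_notMem h1
    rw [h] at h2
    simpa using h2

theorem wc_li {α β : EucV ℓ} (h1 : α ∈ rs.Pos) (h2 : β ∈ rs.Pos) (hne : β ≠ α) {p q : ℝ}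
    (h : p • α + q • β = 0) : p = 0 ∧ q = 0 := by
  by_cases hq : q = 0
  · subst hq
    simp only [zero_smul, add_zero, smul_eq_zero] at h
    exact ⟨h.resolve_right (fun e => rs.nonzero (e ▸ h1.1)), rfl⟩
  · exfalso
    apply hne
    refine rs.wc_eq_of_smul h1 h2 (t := - (p / q)) ?_
    have : q • β = - (p • α) := by rw [eq_neg_iff_add_eq_zero, add_comm]; exact h
    calc β = q⁻¹ • (q • β) := by rw [smul_smul, inv_mul_cancel₀ hq, one_smul]
      _ = _ := by rw [this, smul_neg, smul_smul, neg_smul]; congr 2; field_simp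

theorem wc_plane (hirr : IrredSet rs.Φ) (hG2 : ¬ (ℓ = 2 ∧ rs.Pos.ncard = 6))
    {x y δ : EucV ℓ} (hx : x ∈ rs.Pos) (hy : y ∈ rs.Pos) (hδ : δ ∈ rs.Φ)
    (hxy : ⟪x, y⟫_ℝ < 0) {p q : ℝ} (hp : 0 < p) (hq : 0 < q) (h : δ = p • x - q • y) : False := by
  have hc : ⟪y, x⟫_ℝ = ⟪x, y⟫_ℝ := real_inner_comm _ _
  obtain ⟨n, k, hn, hk, b0, b4, bz⟩ := rs.wc_cartan hx.1 hy.1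
  obtain ⟨i, i', hi, hi', c0, c4, cz⟩ := rs.wc_cartan hx.1 hδ
  obtain ⟨j, j', hj, hj', d0, d4, dz⟩ := rs.wc_cartan hy.1 hδ
  have b3 := rs.wc_no_g2 hirr hG2 hx.1 hy.1 hn hk
  have c3 := rs.wc_no_g2 hirr hG2 hx.1 hδ hi hi'
  have d3 := rs.wc_no_g2 hirr hG2 hy.1 hδ hj hj'
  have px := rs.wc_inner_self_pos hx.1
  have py := rs.wc_inner_self_pos hy.1
  have pδ := rs.wc_inner_self_pos hδ
  have ib := wc_int_bound b0 b4 bz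
  have ic := wc_int_bound c0 c4 cz
  have id' := wc_int_bound d0 d4 dz
  have hne : y ≠ x := by rintro rfl; linarith
  have bne4 : n * k ≠ 4 := by
    intro h4
    exact hne (rs.wc_eq_of_smul hx hy (rs.wc_collinear hx.1 hn hk h4))
  rw [hc] at hn hk
  have sgn : ∀ (a : ℤ) (s N : ℝ), 2 * s = a * N → 0 < N → s < 0 → a < 0 := by
    intro a s N e hN hs
    have : (a : ℝ) < 0 := by
      by_contra hh
      have := mul_nonneg (not_lt.1 hh) hN.le
      linarith
    exact_mod_cast this
  have sgp : ∀ (a : ℤ) (s N : ℝ), 2 * s = a * N → 0 < N → 0 < s → 0 < a := by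
    intro a s N e hN hs
    have : (0 : ℝ) < a := by
      by_contra hh
      have := mul_nonneg (neg_nonneg.2 (not_lt.1 hh)) hN.le
      linarith
    exact_mod_cast this
  have n0 := sgn _ _ _ hn px hxy
  have k0 := sgn _ _ _ hk py hxy
  have ex : ⟪δ, x⟫_ℝ = p * ⟪x, x⟫_ℝ - q * ⟪x, y⟫_ℝ := by
    rw [h, inner_sub_left, inner_smul_left, inner_smul_left, hc]; simp
  have ey : ⟪δ, y⟫_ℝ = p * ⟪x, y⟫_ℝ - q * ⟪y, y⟫_ℝ := by
    rw [h, inner_sub_left, inner_smul_left, inner_smul_left]; simp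
  have eδ : ⟪δ, δ⟫_ℝ = p * ⟪δ, x⟫_ℝ - q * ⟪δ, y⟫_ℝ := by
    nth_rewrite 2 [h]; rw [inner_sub_right, inner_smul_right, inner_smul_right]
  have sx : 0 < ⟪δ, x⟫_ℝ := by rw [ex]; nlinarith [mul_pos hp px, mul_pos hq (neg_pos.2 hxy)]
  have sy : ⟪δ, y⟫_ℝ < 0 := by rw [ey]; nlinarith [mul_pos hq py, mul_pos hp (neg_pos.2 hxy)]
  have i0 := sgp _ _ _ hi px sx
  have i0' := sgp _ _ _ hi' pδ sx
  have j0 := sgn _ _ _ hj py sy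
  have j0' := sgn _ _ _ hj' pδ sy
  simp only [Finset.mem_Icc] at ib ic id'
  -- real relations
  have r1 : (i : ℝ) = 2 * p - q * n := by
    apply mul_right_cancel₀ px.ne'
    linear_combination -hi + 2 * ex - q * hn
  have r2 : (j : ℝ) = k * p - 2 * q := by
    apply mul_right_cancel₀ py.ne'
    linear_combination -hj + 2 * ey + p * hk
  have r3 : (2 : ℝ) = p * i' - q * j' := by
    apply mul_right_cancel₀ pδ.ne'
    linear_combination 2 * eδ + p * hi' - q * hj'
  have r4 : n * i' * j = k * j' * i := by
    have : (n : ℝ) * i' * j = k * j' * i := by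
      apply mul_right_cancel₀ pδ.ne'
      linear_combination (-(n : ℝ) * j) * hi' + ((n : ℝ) * j) * hi + (-(i : ℝ) * j) * hn
        + ((i : ℝ) * j) * hk - (i * k : ℝ) * hj + (i * k : ℝ) * hj'
    exact_mod_cast this
  have hnk : n * k ≤ 2 := by omega
  have hnk' : (0 : ℝ) < 4 - n * k := by
    have : ((n * k : ℤ) : ℝ) ≤ 2 := by exact_mod_cast hnk
    push_cast at this; linarith
  have s1 : (2 : ℝ) * i - n * j = p * (4 - n * k) := by rw [r1, r2]; ring
  have s2 : (k : ℝ) * i - 2 * j = q * (4 - n * k) := by rw [r1, r2]; ring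
  refine wc_int_plane n (by simp; omega) k (by simp; omega) hnk i (by simp; omega) i'
    (by simp; omega) c4 c3 j (by simp; omega) j' (by simp; omega) d4 d3 r4 ?_ ?_ ?_
  · have := mul_pos hp hnk'
    rw [← s1] at this
    exact_mod_cast this
  · have := mul_pos hq hnk'
    rw [← s2] at this
    exact_mod_cast this
  · have : (2 : ℝ) * (4 - n * k) = (2 * i - n * j) * i' - (k * i - 2 * j) * j' := by
      rw [s1, s2]; linear_combination (4 - n * k : ℝ) * r3
    exact_mod_cast this

end RootSystemData


/-! ### Alcoves -/

theorem wc_alcove_box {ℓ : ℕ} {P A : Set (EucV ℓ)} {r : EucV ℓ → ℤ} (hA : IsAlcove Set.univ P A)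
    (hr : IsAddress P A r) {y : EucV ℓ}
    (hy : ∀ δ ∈ P, (r δ : ℝ) - 1 < ⟪δ, y⟫_ℝ ∧ ⟪δ, y⟫_ℝ < r δ) : y ∈ A := by
  obtain ⟨x, hx, rfl⟩ := hA
  have hxA := mem_connectedComponentIn hx
  have hseg : IsPreconnected (segment ℝ x y) := (convex_segment x y).isPreconnected
  refine hseg.subset_connectedComponentIn (left_mem_segment ℝ x y) ?_ (right_mem_segment ℝ x y)
  rintro z ⟨s, t, hs, ht, hst, rfl⟩
  refine ⟨Set.mem_univ _, ?_⟩
  rintro ⟨-, δ, hδ, n, hn⟩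
  obtain ⟨u1, u2⟩ := hr δ hδ x hxA
  obtain ⟨v1, v2⟩ := hy δ hδ
  rw [inner_add_right, inner_smul_right, inner_smul_right] at hn
  have hco := (convex_Ioo ((r δ : ℝ) - 1) (r δ : ℝ)) ⟨u1, u2⟩ ⟨v1, v2⟩ hs ht hst
  rw [smul_eq_mul, smul_eq_mul, hn] at hco
  obtain ⟨w1, w2⟩ := hco
  have w1' : r δ - 1 < n := by exact_mod_cast w1
  have w2' : n < r δ := by exact_mod_cast w2
  omega

theorem wc_alcove_nonempty {ℓ : ℕ} {P A : Set (EucV ℓ)} (hA : IsAlcove Set.univ P A) :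
    A.Nonempty := by
  obtain ⟨x, hx, rfl⟩ := hA
  exact ⟨x, mem_connectedComponentIn hx⟩

theorem wc_closure_le {ℓ : ℕ} {P A : Set (EucV ℓ)} {r : EucV ℓ → ℤ} (hr : IsAddress P A r)
    {y : EucV ℓ} (hy : y ∈ closure A) {δ : EucV ℓ} (hδ : δ ∈ P) : ⟪δ, y⟫_ℝ ≤ r δ := by
  have hcl : IsClosed {z : EucV ℓ | ⟪δ, z⟫_ℝ ≤ r δ} :=
    isClosed_le (by fun_prop) continuous_const
  exact closure_minimal (fun z hz => (hr δ hδ z hz).2.le) hcl hy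

theorem wc_mem_closure {ℓ : ℕ} {P A : Set (EucV ℓ)} {r : EucV ℓ → ℤ} (hA : IsAlcove Set.univ P A)
    (hr : IsAddress P A r) {y : EucV ℓ}
    (hy : ∀ δ ∈ P, (r δ : ℝ) - 1 ≤ ⟪δ, y⟫_ℝ ∧ ⟪δ, y⟫_ℝ ≤ r δ) : y ∈ closure A := by
  obtain ⟨a, ha⟩ := wc_alcove_nonempty hA
  have hlim : Filter.Tendsto (fun t : ℝ => y + t • (a - y)) (nhdsWithin 0 (Set.Ioi 0)) (nhds y) := by
    have : Continuous (fun t : ℝ => y + t • (a - y)) := by fun_prop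
    have h := this.tendsto 0
    simp only [zero_smul, add_zero] at h
    exact h.mono_left nhdsWithin_le_nhds
  refine mem_closure_of_tendsto hlim ?_
  have h1 : ∀ᶠ t : ℝ in nhdsWithin 0 (Set.Ioi 0), t ∈ Set.Ioo (0 : ℝ) 1 :=
    Ioo_mem_nhdsGT one_pos
  filter_upwards [h1] with t ht
  refine wc_alcove_box hA hr fun δ hδ => ?_
  obtain ⟨u1, u2⟩ := hr δ hδ a ha
  obtain ⟨v1, v2⟩ := hy δ hδ
  rw [inner_add_right, inner_smul_right, inner_sub_right]
  constructor <;> nlinarith [ht.1, ht.2]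

/-- A component of the complement has an address. -/
theorem wc_alcove_address {ℓ : ℕ} {P : Set (EucV ℓ)} {r : EucV ℓ → ℤ} {a : EucV ℓ}
    (ha : ∀ δ ∈ P, (r δ : ℝ) - 1 < ⟪δ, a⟫_ℝ ∧ ⟪δ, a⟫_ℝ < r δ) :
    ∃ A, IsAlcove Set.univ P A ∧ IsAddress P A r := by
  have ha' : a ∈ Set.univ \ hypUnion Set.univ P := by
    refine ⟨Set.mem_univ _, ?_⟩
    rintro ⟨-, δ, hδ, n, hn⟩
    obtain ⟨u1, u2⟩ := ha δ hδ
    rw [hn] at u1 u2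
    have w1' : r δ - 1 < n := by exact_mod_cast u1
    have w2' : n < r δ := by exact_mod_cast u2
    omega
  refine ⟨_, ⟨a, ha', rfl⟩, ?_⟩
  intro δ hδ y hy
  set F := Set.univ \ hypUnion Set.univ P
  have hpre : IsPreconnected ((fun z => ⟪δ, z⟫_ℝ) '' connectedComponentIn F a) :=
    isPreconnected_connectedComponentIn.image _ (by fun_prop)
  have hord := hpre.ordConnected
  have hnot : ∀ n : ℤ, (n : ℝ) ∉ (fun z => ⟪δ, z⟫_ℝ) '' connectedComponentIn F a := by
    rintro n ⟨z, hz, hzn⟩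
    exact (connectedComponentIn_subset F a hz).2 ⟨Set.mem_univ _, δ, hδ, n, hzn⟩
  have ma : ⟪δ, a⟫_ℝ ∈ (fun z => ⟪δ, z⟫_ℝ) '' connectedComponentIn F a :=
    ⟨a, mem_connectedComponentIn ha', rfl⟩
  have my : ⟪δ, y⟫_ℝ ∈ (fun z => ⟪δ, z⟫_ℝ) '' connectedComponentIn F a := ⟨y, hy, rfl⟩
  obtain ⟨u1, u2⟩ := ha δ hδ
  constructor
  · by_contra hh
    apply hnot (r δ - 1)
    push_cast
    exact hord.out my ma ⟨not_lt.1 hh, u1.le⟩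
  · by_contra hh
    exact hnot (r δ) (hord.out ma my ⟨u2.le, not_lt.1 hh⟩)

/-- A criterion for being a wall. -/
theorem wc_wall {ℓ : ℕ} {P A : Set (EucV ℓ)} (hP : P.Finite) {r : EucV ℓ → ℤ}
    (hA : IsAlcove Set.univ P A) (hr : IsAddress P A r) {β z : EucV ℓ}
    (hz : ⟪β, z⟫_ℝ = r β)
    (hz' : ∀ δ ∈ P, δ ≠ β → (r δ : ℝ) - 1 < ⟪δ, z⟫_ℝ ∧ ⟪δ, z⟫_ℝ < r δ) :
    IsWall Set.univ β (r β) A := by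
  intro y _ hy
  have hev : ∀ᶠ t : ℝ in nhdsWithin 0 (Set.Ioi 0), ∀ δ ∈ P,
      (r δ : ℝ) - 1 ≤ ⟪δ, z + t • (y - z)⟫_ℝ ∧ ⟪δ, z + t • (y - z)⟫_ℝ ≤ r δ := by
    rw [Filter.eventually_all_finite hP]
    intro δ hδ
    by_cases e : δ = β
    · subst e
      refine Filter.Eventually.of_forall fun t => ?_
      rw [inner_add_right, inner_smul_right, inner_sub_right, hy, hz]
      constructor <;> linarith
    · obtain ⟨u1, u2⟩ := hz' δ hδ e
      have hc : Continuous (fun t : ℝ => ⟪δ, z + t • (y - z)⟫_ℝ) := by fun_prop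
      have h := hc.tendsto 0
      simp only [zero_smul, add_zero] at h
      have h' := h.mono_left (nhdsWithin_le_nhds (s := Set.Ioi 0))
      filter_upwards [h'.eventually (lt_mem_nhds u1), h'.eventually (gt_mem_nhds u2)] with t a b
      exact ⟨a.le, b.le⟩
  obtain ⟨t, ht, ht0⟩ := (hev.and self_mem_nhdsWithin).exists
  have ht0 : 0 < t := ht0
  have hzcl : z ∈ closure A := by
    refine wc_mem_closure hA hr fun δ hδ => ?_
    by_cases e : δ = β
    · subst e; rw [hz]; constructor <;> linarith
    · exact ⟨(hz' δ hδ e).1.le, (hz' δ hδ e).2.le⟩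
  have hwcl := wc_mem_closure hA hr ht
  have hwβ : ⟪β, z + t • (y - z)⟫_ℝ = r β := by
    rw [inner_add_right, inner_smul_right, inner_sub_right, hy, hz]; ring
  have m1 : z ∈ affineSpan ℝ ({x ∈ (Set.univ : Set (EucV ℓ)) | ⟪β, x⟫_ℝ = (r β : ℝ)} ∩ closure A) :=
    subset_affineSpan ℝ _ ⟨⟨Set.mem_univ _, hz⟩, hzcl⟩
  have m2 : z + t • (y - z) ∈
      affineSpan ℝ ({x ∈ (Set.univ : Set (EucV ℓ)) | ⟪β, x⟫_ℝ = (r β : ℝ)} ∩ closure A) :=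
    subset_affineSpan ℝ _ ⟨⟨Set.mem_univ _, hwβ⟩, hwcl⟩
  have := AffineMap.lineMap_mem (t⁻¹ : ℝ) m1 m2
  rw [AffineMap.lineMap_apply] at this
  simpa [smul_smul, inv_mul_cancel₀ ht0.ne'] using this


/-! ### Negatively coclosed implies compatible -/

namespace RootSystemData

variable {ℓ : ℕ} (rs : RootSystemData ℓ)

theorem wc_pos_finite : rs.Pos.Finite := rs.finite.subset fun _ h => h.1

theorem wc_int_eq {s : ℝ} {n r : ℤ} (h1 : s = n) (h2 : (r : ℝ) - 1 < s) (h3 : s ≤ r) : s = r := by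
  rw [h1] at h2 h3 ⊢
  have a : r - 1 < n := by exact_mod_cast h2
  have b : n ≤ r := by exact_mod_cast h3
  have : n = r := by omega
  rw [this]

theorem wc_is_wall (hirr : IrredSet rs.Φ) (hG2 : ¬ (ℓ = 2 ∧ rs.Pos.ncard = 6))
    {A : Set (EucV ℓ)} {r : EucV ℓ → ℤ} (hA : IsAlcove Set.univ rs.Pos A)
    (hr : IsAddress rs.Pos A r) {x : EucV ℓ} (hx : x ∈ upperClos rs.Pos A r)
    {β : EucV ℓ} (hβ : β ∈ rs.Pos) (hβx : ⟪β, x⟫_ℝ = r β)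
    (H : ∀ δ ∈ rs.Pos, ⟪δ, x⟫_ℝ = r δ → 0 < ⟪β, δ⟫_ℝ →
      ∀ k : ℤ, 2 * ⟪β, δ⟫_ℝ = k * ⟪δ, δ⟫_ℝ → β - (k : ℝ) • δ ∉ rs.Pos) :
    IsWall Set.univ β (r β) A := by
  obtain ⟨a, ha⟩ := wc_alcove_nonempty hA
  obtain ⟨hxcl, hxlow⟩ := hx
  have hxup : ∀ δ ∈ rs.Pos, ⟪δ, x⟫_ℝ ≤ r δ := fun δ hδ => wc_closure_le hr hxcl hδ
  have pβ := rs.wc_inner_self_pos hβ.1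
  set u : EucV ℓ := x - a with hu
  have upos : ∀ δ ∈ rs.Pos, ⟪δ, x⟫_ℝ = r δ → 0 < ⟪δ, u⟫_ℝ := by
    intro δ hδ e
    rw [hu, inner_sub_right, e]
    linarith [(hr δ hδ a ha).2]
  set v : EucV ℓ := (⟪β, u⟫_ℝ / ⟪β, β⟫_ℝ) • β - u with hv
  have hβv : ⟪β, v⟫_ℝ = 0 := by
    rw [hv, inner_sub_right, inner_smul_right, div_mul_cancel₀ _ pβ.ne', sub_self]
  have uβ := upos β hβ hβx
  have key : ∀ δ ∈ rs.Pos, δ ≠ β → ⟪δ, x⟫_ℝ = r δ → ⟪δ, v⟫_ℝ < 0 := by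
    intro δ hδ hne e
    have uδ := upos δ hδ e
    have pδ := rs.wc_inner_self_pos hδ.1
    rw [hv, inner_sub_right, inner_smul_right]
    have hc : ⟪δ, β⟫_ℝ = ⟪β, δ⟫_ℝ := real_inner_comm _ _
    rw [hc]
    rcases le_or_gt ⟪β, δ⟫_ℝ 0 with hle | hgt
    · have := mul_nonneg (div_nonneg uβ.le pβ.le) (neg_nonneg.2 hle)
      linarith
    · obtain ⟨k, k', hk, hk', b0, b4, bz⟩ := rs.wc_cartan hδ.1 hβ.1
      have b3 := rs.wc_no_g2 hirr hG2 hδ.1 hβ.1 hk hk'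
      have bne : k * k' ≠ 4 := fun h4 =>
        hne (rs.wc_eq_of_smul hδ hβ (rs.wc_collinear hδ.1 hk hk' h4)).symm
      have b2 : k * k' ≤ 2 := by omega
      have hnot := H δ hδ e hgt k hk
      have hmem : β - (k : ℝ) • δ ∈ rs.Φ := rs.wc_refl hδ.1 hβ.1 hk
      have hγ : -(β - (k : ℝ) • δ) ∈ rs.Pos := (rs.wc_pos_or_neg hmem).resolve_left hnot
      have hγx : ⟪-(β - (k : ℝ) • δ), x⟫_ℝ = ((k * r δ - r β : ℤ) : ℝ) := by
        rw [inner_neg_left, inner_sub_left, inner_smul_left, hβx, e]; simp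
      have hγr := wc_int_eq hγx (hxlow _ hγ) (hxup _ hγ)
      have uγ := upos _ hγ hγr
      rw [inner_neg_left, inner_sub_left, inner_smul_left] at uγ
      simp only [RCLike.conj_to_real] at uγ
      have e1 : ⟪β, u⟫_ℝ / ⟪β, β⟫_ℝ * ⟪β, δ⟫_ℝ = ⟪β, u⟫_ℝ * (k' / 2) := by
        have : ⟪β, δ⟫_ℝ = k' / 2 * ⟪β, β⟫_ℝ := by linarith
        rw [this]; field_simp
      rw [e1]
      have hk'pos : (0 : ℝ) < k' := by
        by_contra hh
        have := mul_nonneg (neg_nonneg.2 (not_lt.1 hh)) pβ.le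
        linarith
      have b2' : (k : ℝ) * k' ≤ 2 := by exact_mod_cast b2
      have s1 : ⟪β, u⟫_ℝ * k' < (k * ⟪δ, u⟫_ℝ) * k' :=
        mul_lt_mul_of_pos_right (by linarith) hk'pos
      have s2 : (k * k' : ℝ) * ⟪δ, u⟫_ℝ ≤ 2 * ⟪δ, u⟫_ℝ := mul_le_mul_of_nonneg_right b2' uδ.le
      linarith
  have hev : ∀ᶠ t : ℝ in nhdsWithin 0 (Set.Ioi 0), ∀ δ ∈ rs.Pos, δ ≠ β →
      (r δ : ℝ) - 1 < ⟪δ, x + t • v⟫_ℝ ∧ ⟪δ, x + t • v⟫_ℝ < r δ := by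
    rw [Filter.eventually_all_finite rs.wc_pos_finite]
    intro δ hδ
    by_cases hne : δ = β
    · exact Filter.Eventually.of_forall fun t h => absurd hne h
    have hcn : Continuous (fun t : ℝ => ⟪δ, x + t • v⟫_ℝ) := by fun_prop
    have h := hcn.tendsto 0
    simp only [zero_smul, add_zero] at h
    have h' := h.mono_left (nhdsWithin_le_nhds (s := Set.Ioi 0))
    rcases (hxup δ hδ).lt_or_eq with hlt | heq
    · filter_upwards [h'.eventually (lt_mem_nhds (hxlow δ hδ)),
        h'.eventually (gt_mem_nhds hlt)] with t a b _
      exact ⟨a, b⟩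
    · have := key δ hδ hne heq
      filter_upwards [h'.eventually (lt_mem_nhds (hxlow δ hδ)), self_mem_nhdsWithin] with t a b _
      refine ⟨a, ?_⟩
      have b : 0 < t := b
      rw [inner_add_right, inner_smul_right, heq]
      nlinarith
  obtain ⟨t, ht⟩ := hev.exists
  refine wc_wall rs.wc_pos_finite hA hr (z := x + t • v) ?_ ht
  rw [inner_add_right, inner_smul_right, hβv, hβx]; simp

theorem wc_backward (hirr : IrredSet rs.Φ) (hG2 : ¬ (ℓ = 2 ∧ rs.Pos.ncard = 6))
    {S : Set (EucV ℓ)} (hS : S ⊆ rs.Pos) (hN : NegCoclosed rs.Pos S) :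
    WCompat Set.univ rs.Pos rs.Δ S := by
  intro A hA hAP r hr α hα n
  by_cases hemp : upperClos rs.Pos A r ∩ {x : EucV ℓ | ⟪α, x⟫_ℝ = (n : ℝ)} = ∅
  · exact Or.inl hemp
  right
  obtain ⟨x, hxU, hxn⟩ := Set.nonempty_iff_ne_empty.2 hemp
  have hxn : ⟪α, x⟫_ℝ = (n : ℝ) := hxn
  have hup : ∀ y ∈ upperClos rs.Pos A r, ∀ δ ∈ rs.Pos, ⟪δ, y⟫_ℝ ≤ r δ :=
    fun y hy δ hδ => wc_closure_le hr hy.1 hδ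
  obtain ⟨a, ha⟩ := wc_alcove_nonempty hA
  -- all roots are positive on `A`, hence `1 ≤ r`
  have hr1 : ∀ δ ∈ rs.Pos, 1 ≤ r δ := by
    intro δ hδ
    have : 0 ≤ ⟪δ, a⟫_ℝ := by
      obtain ⟨s, c, hs, e⟩ := hδ.2
      rw [e, sum_inner]
      refine Finset.sum_nonneg fun b hb => ?_
      rw [inner_smul_left]
      exact mul_nonneg (by simp) ((hAP ha).2 b (hs hb)).1.le
    have h2 := (hr δ hδ a ha).2
    have : (0 : ℝ) < r δ := by linarith
    have : 0 < r δ := by exact_mod_cast this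
    omega
  have hxpos : ∀ δ ∈ rs.Pos, 0 < ⟪δ, x⟫_ℝ := by
    intro δ hδ
    have := hxU.2 δ hδ
    have h1 : (1 : ℝ) ≤ r δ := by exact_mod_cast hr1 δ hδ
    linarith
  have main : ∀ N : ℕ, ∀ β ∈ S, ∀ b : ℤ, ⟪β, x⟫_ℝ = b → b ≤ N →
      ∃ γ ∈ S, IsWall Set.univ γ (r γ) A ∧
        ∀ y ∈ upperClos rs.Pos A r, ⟪β, y⟫_ℝ = r β → ⟪γ, y⟫_ℝ = r γ := by
    intro N
    induction N with
    | zero =>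
      intro β hβ b hb hle
      have := hxpos β (hS hβ)
      rw [hb] at this
      have : 0 < b := by exact_mod_cast this
      simp at hle
      omega
    | succ N ih =>
      intro β hβ b hb hle
      have hβP := hS hβ
      have hβr := wc_int_eq hb (hxU.2 _ hβP) (hup x hxU _ hβP)
      by_cases H : ∀ δ ∈ rs.Pos, ⟪δ, x⟫_ℝ = r δ → 0 < ⟪β, δ⟫_ℝ →
          ∀ k : ℤ, 2 * ⟪β, δ⟫_ℝ = k * ⟪δ, δ⟫_ℝ → β - (k : ℝ) • δ ∉ rs.Pos
      · exact ⟨β, hβ, rs.wc_is_wall hirr hG2 hA hr hxU hβP hβr H, fun y _ h => h⟩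
      push Not at H
      obtain ⟨δ, hδ, hδx, hpos, k, hk, hmem⟩ := H
      have pδ := rs.wc_inner_self_pos hδ.1
      have hkpos : 0 < k := by
        have : (0 : ℝ) < k := by
          by_contra hh
          have := mul_nonneg (neg_nonneg.2 (not_lt.1 hh)) pδ.le
          linarith
        exact_mod_cast this
      have hkR : (1 : ℝ) ≤ k := by exact_mod_cast hkpos
      set ε := β - (k : ℝ) • δ with hε
      have hsum : ∀ y, ⟪β, y⟫_ℝ = ⟪ε, y⟫_ℝ + k * ⟪δ, y⟫_ℝ := by
        intro y
        rw [hε, inner_sub_left, inner_smul_left]; simp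
      have hεx : ⟪ε, x⟫_ℝ = ((b - k * r δ : ℤ) : ℝ) := by
        have := hsum x
        rw [hb, hδx] at this
        push_cast; linarith
      have hεr := wc_int_eq hεx (hxU.2 _ hmem) (hup x hxU _ hmem)
      have hneg : ⟪ε, δ⟫_ℝ < 0 := by
        rw [hε, inner_sub_left, inner_smul_left]
        simp only [RCLike.conj_to_real]
        linarith
      have hrsum : (r β : ℝ) = r ε + k * r δ := by
        rw [← hβr, hsum x, hεr, hδx]
      have hy : ∀ y ∈ upperClos rs.Pos A r, ⟪β, y⟫_ℝ = r β →
          ⟪ε, y⟫_ℝ = r ε ∧ ⟪δ, y⟫_ℝ = r δ := by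
        intro y hyU hyβ
        have h1 := hup y hyU _ hmem
        have h2 := hup y hyU _ hδ
        have h3 := hsum y
        rw [hyβ, hrsum] at h3
        have h4 : (r δ : ℝ) - ⟪δ, y⟫_ℝ ≤ k * ((r δ : ℝ) - ⟪δ, y⟫_ℝ) :=
          le_mul_of_one_le_left (by linarith) hkR
        constructor <;> linarith
      have bval : (b : ℝ) = ⟪ε, x⟫_ℝ + k * r δ := by rw [← hb, hsum x, hδx]
      have p1 := hxpos ε hmem
      have p2 := hxpos δ hδ
      rw [hδx] at p2
      have p3 : (r δ : ℝ) ≤ k * r δ := le_mul_of_one_le_left p2.le hkR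
      rcases hN β hβ ε hmem δ hδ 1 k one_pos hkpos (by rw [hε]; simp) hneg with h | h
      · obtain ⟨γ, hγ, hw, hγy⟩ := ih ε h (r ε) hεr (by
          have : (r ε : ℝ) < b := by rw [bval, hεr]; linarith
          have : r ε < b := by exact_mod_cast this
          push_cast at hle
          omega)
        exact ⟨γ, hγ, hw, fun y hyU e => hγy y hyU (hy y hyU e).1⟩
      · obtain ⟨γ, hγ, hw, hγy⟩ := ih δ h (r δ) hδx (by
          have : (r δ : ℝ) < b := by rw [bval]; linarith
          have : r δ < b := by exact_mod_cast this
          push_cast at hle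
          omega)
        exact ⟨γ, hγ, hw, fun y hyU e => hγy y hyU (hy y hyU e).2⟩
  obtain ⟨γ, hγ, hw, hγy⟩ := main n.toNat α hα n hxn (Int.self_le_toNat n)
  refine ⟨γ, hγ, r γ, rfl, hr1 γ (hS hγ), hw, ?_⟩
  rintro y ⟨hyU, hyn⟩
  exact hγy y hyU (wc_int_eq hyn (hyU.2 _ (hS hα)) (hup y hyU _ (hS hα)))

end RootSystemData


/-! ### Compatible implies negatively coclosed -/

theorem wc_ev_not_int (s : ℝ) {c : ℝ} (hc : c ≠ 0) :
    ∀ᶠ t : ℝ in nhdsWithin 0 (Set.Ioi 0), ∀ n : ℤ, s + t * c ≠ n := by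
  have hcn : Continuous (fun t : ℝ => s + t * c) := by fun_prop
  have h := hcn.tendsto 0
  simp only [zero_mul, add_zero] at h
  have h' := h.mono_left (nhdsWithin_le_nhds (s := Set.Ioi 0))
  rcases lt_or_gt_of_ne hc with hneg | hpos
  · have hlt : ((⌈s⌉ - 1 : ℤ) : ℝ) < s := by
      have := Int.ceil_lt_add_one s
      push_cast; linarith
    filter_upwards [h'.eventually (lt_mem_nhds hlt), self_mem_nhdsWithin] with t a b n e
    have b : 0 < t := b
    rw [e] at a
    have h2 : (n : ℝ) < (⌈s⌉ : ℤ) := by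
      rw [← e]
      have := Int.le_ceil s
      have := mul_neg_of_pos_of_neg b hneg
      linarith
    have a' : ⌈s⌉ - 1 < n := by exact_mod_cast a
    have h2' : n < ⌈s⌉ := by exact_mod_cast h2
    omega
  · have hlt : s < ((⌊s⌋ + 1 : ℤ) : ℝ) := by
      have := Int.lt_floor_add_one s
      push_cast; linarith
    filter_upwards [h'.eventually (gt_mem_nhds hlt), self_mem_nhdsWithin] with t a b n e
    have b : 0 < t := b
    rw [e] at a
    have h2 : ((⌊s⌋ : ℤ) : ℝ) < n := by
      rw [← e]
      have := Int.floor_le s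
      have := mul_pos b hpos
      linarith
    have a' : n < ⌊s⌋ + 1 := by exact_mod_cast a
    have h2' : ⌊s⌋ < n := by exact_mod_cast h2
    omega

namespace RootSystemData

variable {ℓ : ℕ} (rs : RootSystemData ℓ)

theorem wc_base_point {β₁ β₂ : EucV ℓ} (h1 : β₁ ∈ rs.Pos) (h2 : β₂ ∈ rs.Pos) (hne : β₂ ≠ β₁) :
    ∃ x : EucV ℓ, (∀ δ ∈ rs.Δ, 0 < ⟪δ, x⟫_ℝ ∧ ⟪δ, x⟫_ℝ ≤ 1) ∧ (∃ n : ℤ, ⟪β₁, x⟫_ℝ = n) ∧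
      (∃ n : ℤ, ⟪β₂, x⟫_ℝ = n) ∧
      ∀ δ ∈ rs.Δ, ⟪δ, x⟫_ℝ = 1 → δ ∈ Submodule.span ℝ {β₁, β₂} := by
  classical
  haveI : Fintype rs.Δ := (rs.finite.subset rs.simple_sub).fintype
  have hnat : ∀ β ∈ rs.Pos, ∀ i, 0 ≤ rs.wcBasis.repr β i ∧ ∃ n : ℤ, rs.wcBasis.repr β i = n := by
    intro β hβ i
    obtain ⟨n, hn⟩ := rs.wc_repr_nat hβ.2 i
    rw [hn]
    exact ⟨Nat.cast_nonneg n, n, by simp⟩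
  obtain ⟨f, hf1, hf2, hf3, hf4⟩ := wc_abs_point (fun i => rs.wcBasis.repr β₁ i)
    (fun i => rs.wcBasis.repr β₂ i) (fun i => (hnat _ h1 i).1) (fun i => (hnat _ h2 i).1)
    (fun i => (hnat _ h1 i).2) (fun i => (hnat _ h2 i).2) (by
      by_contra hcon
      push Not at hcon
      have : ∃ i, rs.wcBasis.repr β₁ i ≠ 0 := by
        by_contra h0
        push Not at h0
        apply rs.nonzero
        have : β₁ = 0 := by
          apply rs.wcBasis.repr.injective
          ext i
          simp [h0 i]
        exact this ▸ h1.1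
      obtain ⟨i, hi⟩ := this
      have hz : (-(rs.wcBasis.repr β₂ i)) • β₁ + (rs.wcBasis.repr β₁ i) • β₂ = 0 := by
        apply rs.wcBasis.repr.injective
        ext j
        have := hcon i j
        simp only [map_add, map_smul, map_zero, Finsupp.add_apply, Finsupp.smul_apply, smul_eq_mul,
          Finsupp.zero_apply]
        linear_combination this
      exact hi (rs.wc_li h1 h2 hne hz).2)
  obtain ⟨x, hx⟩ := rs.wc_exists_coord f
  refine ⟨x, ?_, ?_, ?_, ?_⟩
  · intro δ hδ
    have := hx ⟨δ, hδ⟩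
    simp only at this
    rw [this]
    exact hf1 _
  · rw [rs.wc_inner_eq_sum β₁ x]
    simpa only [hx] using hf2
  · rw [rs.wc_inner_eq_sum β₂ x]
    simpa only [hx] using hf3
  · intro δ hδ he
    have := hx ⟨δ, hδ⟩
    simp only at this
    rw [this] at he
    obtain ⟨p, q, e1, e2⟩ := hf4 _ he
    rw [Submodule.mem_span_pair]
    refine ⟨p, q, ?_⟩
    apply rs.wcBasis.repr.injective
    have hs : rs.wcBasis.repr δ = Finsupp.single ⟨δ, hδ⟩ 1 := by
      rw [← rs.wcBasis.repr_self ⟨δ, hδ⟩, rs.wcBasis_apply]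
    rw [hs]
    ext m
    simp only [map_add, map_smul, Finsupp.add_apply, Finsupp.smul_apply, smul_eq_mul]
    by_cases hm : m = ⟨δ, hδ⟩
    · subst hm; rw [e1]; simp
    · rw [e2 m hm, Finsupp.single_eq_of_ne hm]

theorem wc_generic (W : Submodule ℝ (EucV ℓ)) :
    ∃ z ∈ Wᗮ, ∀ δ ∈ rs.Pos, δ ∉ W → ⟪δ, z⟫_ℝ ≠ 0 := by
  classical
  haveI : Finite {δ : EucV ℓ // δ ∈ rs.Pos ∧ δ ∉ W} :=
    (rs.wc_pos_finite.subset (t := {δ | δ ∈ rs.Pos ∧ δ ∉ W}) fun _ h => h.1).to_subtype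
  obtain ⟨z, hz, hz'⟩ := Module.Dual.exists_forall_mem_ne_zero_of_forall_exists Wᗮ
    (fun δ : {δ : EucV ℓ // δ ∈ rs.Pos ∧ δ ∉ W} => (innerSL ℝ (δ : EucV ℓ)).toLinearMap) (by
      rintro ⟨δ, hδ, hW⟩
      by_contra hcon
      push Not at hcon
      apply hW
      rw [← Submodule.orthogonal_orthogonal W, Submodule.mem_orthogonal']
      intro u hu
      simpa using hcon u hu)
  exact ⟨z, hz, fun δ hδ hW => by simpa using hz' ⟨δ, hδ, hW⟩⟩

theorem wc_good_point {β₁ β₂ : EucV ℓ} (h1 : β₁ ∈ rs.Pos) (h2 : β₂ ∈ rs.Pos) (hne : β₂ ≠ β₁) :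
    ∃ x : EucV ℓ, (∀ δ ∈ rs.Δ, 0 < ⟪δ, x⟫_ℝ ∧ ⟪δ, x⟫_ℝ ≤ 1) ∧ (∃ n : ℤ, ⟪β₁, x⟫_ℝ = n) ∧
      (∃ n : ℤ, ⟪β₂, x⟫_ℝ = n) ∧
      ∀ δ ∈ rs.Pos, (∃ n : ℤ, ⟪δ, x⟫_ℝ = n) → δ ∈ Submodule.span ℝ {β₁, β₂} := by
  obtain ⟨x, hx1, hx2, hx3, hx4⟩ := rs.wc_base_point h1 h2 hne
  set W := Submodule.span ℝ {β₁, β₂} with hW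
  obtain ⟨z, hz, hz'⟩ := rs.wc_generic W
  have hzW : ∀ δ ∈ W, ∀ t : ℝ, ⟪δ, x + t • z⟫_ℝ = ⟪δ, x⟫_ℝ := by
    intro δ hδ t
    rw [inner_add_right, inner_smul_right, (Submodule.mem_orthogonal W z).1 hz δ hδ]
    simp
  have m1 : β₁ ∈ W := Submodule.subset_span (by simp)
  have m2 : β₂ ∈ W := Submodule.subset_span (by simp)
  have ev1 : ∀ᶠ t : ℝ in nhdsWithin 0 (Set.Ioi 0), ∀ δ ∈ rs.Pos, δ ∉ W →
      ∀ n : ℤ, ⟪δ, x + t • z⟫_ℝ ≠ n := by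
    rw [Filter.eventually_all_finite rs.wc_pos_finite]
    intro δ hδ
    by_cases hw : δ ∈ W
    · exact Filter.Eventually.of_forall fun t h => absurd hw h
    filter_upwards [wc_ev_not_int ⟪δ, x⟫_ℝ (hz' δ hδ hw)] with t ht _ n
    rw [inner_add_right, inner_smul_right]
    exact ht n
  have ev2 : ∀ᶠ t : ℝ in nhdsWithin 0 (Set.Ioi 0), ∀ δ ∈ rs.Δ,
      0 < ⟪δ, x + t • z⟫_ℝ ∧ ⟪δ, x + t • z⟫_ℝ ≤ 1 := by
    rw [Filter.eventually_all_finite (rs.finite.subset rs.simple_sub)]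
    intro δ hδ
    by_cases hw : δ ∈ W
    · exact Filter.Eventually.of_forall fun t => by rw [hzW δ hw]; exact hx1 δ hδ
    have hcn : Continuous (fun t : ℝ => ⟪δ, x + t • z⟫_ℝ) := by fun_prop
    have h := hcn.tendsto 0
    simp only [zero_smul, add_zero] at h
    have h' := h.mono_left (nhdsWithin_le_nhds (s := Set.Ioi 0))
    have hlt : ⟪δ, x⟫_ℝ < 1 := lt_of_le_of_ne (hx1 δ hδ).2 fun e => hw (hx4 δ hδ e)
    filter_upwards [h'.eventually (lt_mem_nhds (hx1 δ hδ).1),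
      h'.eventually (gt_mem_nhds hlt)] with t a b
    exact ⟨a, b.le⟩
  obtain ⟨t, ht1, ht2⟩ := (ev1.and ev2).exists
  refine ⟨x + t • z, ht2, ?_, ?_, ?_⟩
  · rw [hzW _ m1]; exact hx2
  · rw [hzW _ m2]; exact hx3
  · rintro δ hδ ⟨n, hn⟩
    by_contra hw
    exact ht1 δ hδ hw n hn

theorem wc_pos_of_simple {x : EucV ℓ} (hx : ∀ δ ∈ rs.Δ, 0 < ⟪δ, x⟫_ℝ) :
    ∀ δ ∈ rs.Pos, 0 < ⟪δ, x⟫_ℝ := by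
  classical
  intro δ hδ
  obtain ⟨s, c, hs, e⟩ := hδ.2
  have hnn : ∀ b ∈ s, 0 ≤ (c b : ℝ) * ⟪b, x⟫_ℝ := fun b hb =>
    mul_nonneg (by simp) (hx b (hs hb)).le
  have hval : ⟪δ, x⟫_ℝ = ∑ b ∈ s, (c b : ℝ) * ⟪b, x⟫_ℝ := by
    rw [e, sum_inner]
    exact Finset.sum_congr rfl fun b _ => by rw [inner_smul_left]; simp
  rw [hval]
  refine lt_of_le_of_ne (Finset.sum_nonneg hnn) fun h0 => ?_
  have hz := (Finset.sum_eq_zero_iff_of_nonneg hnn).1 h0.symm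
  apply rs.nonzero
  have : δ = 0 := by
    rw [e]
    refine Finset.sum_eq_zero fun b hb => ?_
    rw [(mul_eq_zero.1 (hz b hb)).resolve_right (hx b (hs hb)).ne', zero_smul]
  exact this ▸ hδ.1

/-- The alcove having a given point of the parallelepiped in its upper closure. -/
theorem wc_alcove_of_point {x : EucV ℓ} (hx : ∀ δ ∈ rs.Δ, 0 < ⟪δ, x⟫_ℝ ∧ ⟪δ, x⟫_ℝ ≤ 1) :
    ∃ A r, IsAlcove Set.univ rs.Pos A ∧ IsAddress rs.Pos A r ∧ A ⊆ fundPar Set.univ rs.Δ ∧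
      x ∈ upperClos rs.Pos A r := by
  have hpos := rs.wc_pos_of_simple fun δ hδ => (hx δ hδ).1
  let r : EucV ℓ → ℤ := fun δ => ⌈⟪δ, x⟫_ℝ⌉
  have hr1 : ∀ δ, (r δ : ℝ) - 1 < ⟪δ, x⟫_ℝ := fun δ => by
    have := Int.ceil_lt_add_one ⟪δ, x⟫_ℝ
    change (⌈⟪δ, x⟫_ℝ⌉ : ℝ) - 1 < _
    linarith
  have hr2 : ∀ δ, ⟪δ, x⟫_ℝ ≤ r δ := fun δ => Int.le_ceil _
  have hev : ∀ᶠ t : ℝ in nhdsWithin 0 (Set.Ioi 0), ∀ δ ∈ rs.Pos,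
      (r δ : ℝ) - 1 < ⟪δ, x - t • x⟫_ℝ ∧ ⟪δ, x - t • x⟫_ℝ < r δ := by
    rw [Filter.eventually_all_finite rs.wc_pos_finite]
    intro δ hδ
    have hcn : Continuous (fun t : ℝ => ⟪δ, x - t • x⟫_ℝ) := by fun_prop
    have h := hcn.tendsto 0
    simp only [zero_smul, sub_zero] at h
    have h' := h.mono_left (nhdsWithin_le_nhds (s := Set.Ioi 0))
    filter_upwards [h'.eventually (lt_mem_nhds (hr1 δ)), self_mem_nhdsWithin] with t a b
    have b : 0 < t := b
    refine ⟨a, ?_⟩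
    rw [inner_sub_right, inner_smul_right]
    have := mul_pos b (hpos δ hδ)
    linarith [hr2 δ]
  obtain ⟨t, ht⟩ := hev.exists
  obtain ⟨A, hA, hAr⟩ := wc_alcove_address ht
  refine ⟨A, r, hA, hAr, ?_, ?_, fun δ _ => hr1 δ⟩
  · intro y hy
    refine ⟨Set.mem_univ _, fun δ hδ => ?_⟩
    have hδP : δ ∈ rs.Pos := ⟨rs.simple_sub hδ, {δ}, fun _ => 1, by simpa using hδ, by simp⟩
    have hrδ : r δ = 1 := by
      apply Int.ceil_eq_iff.2
      have := hx δ hδ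
      constructor <;> norm_num [this]
    obtain ⟨u1, u2⟩ := hAr δ hδP y hy
    rw [hrδ] at u1 u2
    push_cast at u1 u2
    constructor <;> linarith
  · exact wc_mem_closure hA hAr fun δ _ => ⟨(hr1 δ).le, hr2 δ⟩

theorem wc_forward (hirr : IrredSet rs.Φ) (hG2 : ¬ (ℓ = 2 ∧ rs.Pos.ncard = 6))
    {S : Set (EucV ℓ)} (hS : S ⊆ rs.Pos) (hC : WCompat Set.univ rs.Pos rs.Δ S) :
    NegCoclosed rs.Pos S := by
  intro α hα β₁ h1 β₂ h2 d₁ d₂ _ _ hαe hneg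
  have hneg' : ⟪β₂, β₁⟫_ℝ < 0 := by rw [real_inner_comm]; exact hneg
  have hne : β₂ ≠ β₁ := by
    rintro rfl
    linarith [rs.wc_inner_self_pos h1.1]
  obtain ⟨x, hx, ⟨n₁, hn₁⟩, ⟨n₂, hn₂⟩, hgen⟩ := rs.wc_good_point h1 h2 hne
  obtain ⟨A, r, hA, hr, hAP, hxU⟩ := rs.wc_alcove_of_point hx
  have hpos := rs.wc_pos_of_simple fun δ hδ => (hx δ hδ).1
  have hαx : ⟪α, x⟫_ℝ = ((d₁ * n₁ + d₂ * n₂ : ℤ) : ℝ) := by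
    rw [hαe, inner_add_left, inner_smul_left, inner_smul_left, hn₁, hn₂]
    simp
  rcases hC A hA hAP r hr α hα (d₁ * n₁ + d₂ * n₂) with hemp | ⟨β, hβ, m, hm, -, hwall, hsub⟩
  · exact absurd hemp (Set.nonempty_iff_ne_empty.1 ⟨x, hxU, hαx⟩)
  have hβx : ⟪β, x⟫_ℝ = (m : ℝ) := hsub ⟨hxU, hαx⟩
  have hβP := hS hβ
  obtain ⟨p, q, hpq⟩ := Submodule.mem_span_pair.1 (hgen β hβP ⟨m, hβx⟩)
  have hval : ∀ y, ⟪β, y⟫_ℝ = p * ⟪β₁, y⟫_ℝ + q * ⟪β₂, y⟫_ℝ := by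
    intro y
    rw [← hpq, inner_add_left, inner_smul_left, inner_smul_left]; simp
  have r1 := wc_int_eq hn₁ (hxU.2 _ h1) (wc_closure_le hr hxU.1 h1)
  have r2 := wc_int_eq hn₂ (hxU.2 _ h2) (wc_closure_le hr hxU.1 h2)
  have x1 := hpos _ h1
  have x2 := hpos _ h2
  have xβ := hpos _ hβP
  rcases lt_trichotomy p 0 with hp | hp | hp
  · rcases le_or_gt q 0 with hq | hq
    · exfalso
      rw [hval] at xβ
      nlinarith
    · exact (rs.wc_plane hirr hG2 h2 h1 hβP.1 hneg' hq (neg_pos.2 hp)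
        (by rw [← hpq]; module)).elim
  · right
    have : β = q • β₂ := by rw [← hpq, hp]; simp
    rw [← rs.wc_eq_of_smul h2 hβP this]
    exact hβ
  · rcases lt_trichotomy q 0 with hq | hq | hq
    · exact (rs.wc_plane hirr hG2 h1 h2 hβP.1 hneg hp (neg_pos.2 hq)
        (by rw [← hpq]; module)).elim
    · left
      have : β = p • β₁ := by rw [← hpq, hq]; simp
      rw [← rs.wc_eq_of_smul h1 hβP this]
      exact hβ
    exfalso
    have pβ := rs.wc_inner_self_pos hβP.1
    set w : EucV ℓ := β₁ - (⟪β, β₁⟫_ℝ / ⟪β, β⟫_ℝ) • β with hw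
    have hβw : ⟪β, w⟫_ℝ = 0 := by
      rw [hw, inner_sub_right, inner_smul_right, div_mul_cancel₀ _ pβ.ne', sub_self]
    have hmem := hwall (x + w) (Set.mem_univ _) (by rw [inner_add_right, hβw, hβx, add_zero])
    let Q : AffineSubspace ℝ (EucV ℓ) := AffineSubspace.mk' x (ℝ ∙ β₁)ᗮ
    have hle : affineSpan ℝ ({y ∈ (Set.univ : Set (EucV ℓ)) | ⟪β, y⟫_ℝ = (m : ℝ)} ∩ closure A)
        ≤ Q := by
      rw [affineSpan_le]
      rintro y ⟨⟨-, hy⟩, hycl⟩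
      have y1 := wc_closure_le hr hycl h1
      have y2 := wc_closure_le hr hycl h2
      rw [← r1] at y1
      rw [← r2] at y2
      have e : p * (⟪β₁, x⟫_ℝ - ⟪β₁, y⟫_ℝ) + q * (⟪β₂, x⟫_ℝ - ⟪β₂, y⟫_ℝ) = 0 := by
        have e1 := hval x
        have e2 := hval y
        rw [hβx] at e1
        rw [hy] at e2
        linarith
      have hz : ⟪β₁, x⟫_ℝ - ⟪β₁, y⟫_ℝ = 0 := by
        have := mul_nonneg hp.le (sub_nonneg.2 y1)
        have := mul_nonneg hq.le (sub_nonneg.2 y2)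
        have : p * (⟪β₁, x⟫_ℝ - ⟪β₁, y⟫_ℝ) = 0 := by linarith
        exact (mul_eq_zero.1 this).resolve_left hp.ne'
      change y ∈ AffineSubspace.mk' x (ℝ ∙ β₁)ᗮ
      rw [AffineSubspace.mem_mk', Submodule.mem_orthogonal_singleton_iff_inner_right, vsub_eq_sub,
        inner_sub_right]
      linarith
    have hQ := hle hmem
    change x + w ∈ AffineSubspace.mk' x (ℝ ∙ β₁)ᗮ at hQ
    rw [AffineSubspace.mem_mk', Submodule.mem_orthogonal_singleton_iff_inner_right, vsub_eq_sub,
      add_sub_cancel_left] at hQ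
    have hw0 : w = 0 := by
      rw [← inner_self_eq_zero (𝕜 := ℝ)]
      conv_lhs => rw [hw]
      rw [inner_sub_left, inner_smul_left, ← hw, hQ, hβw]
      simp
    have hb1 : β₁ = (⟪β, β₁⟫_ℝ / ⟪β, β⟫_ℝ) • β := sub_eq_zero.1 hw0
    have hb : β₁ = β := rs.wc_eq_of_smul hβP h1 hb1
    rw [← hb] at hpq
    have := (rs.wc_li h1 h2 hne (p := p - 1) (q := q) (by
      rw [sub_smul, one_smul, sub_add_eq_add_sub, hpq, sub_self])).2
    exact hq.ne' this

end RootSystemData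

/-- **Theorem (Abe–Tran, Theorem 1.8, Φ ≠ G₂).**
Let `Φ` be an irreducible crystallographic root system that is not of type `G₂`
(equivalently, not of rank `2` with `|Φ⁺| = 6`). A subset `Σ ⊆ Φ⁺` is
Worpitzky-compatible if and only if `Σ` is negatively coclosed. -/
theorem worpitzky_compatible_iff_negatively_coclosed
    {ℓ : ℕ} (rs : RootSystemData ℓ) (hirr : IrredSet rs.Φ)
    (hG2 : ¬ (ℓ = 2 ∧ rs.Pos.ncard = 6))
    (S : Set (EucV ℓ)) (hS : S ⊆ rs.Pos) :
    WCompat Set.univ rs.Pos rs.Δ S ↔ NegCoclosed rs.Pos S := by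
  exact ⟨rs.wc_forward hirr hG2 hS, rs.wc_backward hirr hG2 hS⟩

end
end
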